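/- arXiv:2406.03238 — 2 statements merged into one kernel-verified Lean document; each statement's English description precedes it below -/
import Mathlib

section
/- Green's formula for hereditary algebras over a finite field: for all finitely generated right Λ-modules M, N, M', N', one has a_M · a_N · a_{M'} · a_{N'} · Σ_{[L]} g^L_{MN} · g^L_{M'N'} · a_L^{-1} = Σ_{[M₁],[M₂],[N₁],[N₂]} q^{-⟨M₁,N₂⟩} · g^M_{M₁M₂} · g^N_{N₁N₂} · g^{M'}_{M₁N₁} · g^{N'}_{M₂N₂} · a_{M₁} · a_{M₂} · a_{N₁} · a_{N₂}, where the sums range over isomorphism classes of finitely generated right Λ-modules (both sums have only finitely many nonzero terms, since g^L_{MN} ≠ 0 forces |L| = |M|·|N|, and the identity is an equality of rational numbers). -/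
/-!
Green's formula for a finite-dimensional hereditary algebra `Λ` over the finite
field `𝔽_q`: for all finitely generated right `Λ`-modules `M N M' N'`,
  a_M a_N a_{M'} a_{N'} ∑_{[L]} g^L_{MN} g^L_{M'N'} / a_L
    = ∑_{[M₁],[M₂],[N₁],[N₂]} q^{-⟨M₁,N₂⟩} g^M_{M₁M₂} g^N_{N₁N₂} g^{M'}_{M₁N₁}
        g^{N'}_{M₂N₂} a_{M₁} a_{M₂} a_{N₁} a_{N₂},
as an identity of rational numbers, the sums ranging over isomorphism classes of
finitely generated right `Λ`-modules.  Right `Λ`-modules are encoded as left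
`Λᵐᵒᵖ`-modules.
-/

open CategoryTheory

namespace GreenModules

variable (Λ : Type) [Ring Λ]

/-- A bundled finitely generated right `Λ`-module (encoded as a left `Λᵐᵒᵖ`-module). -/
structure FinMod where
  carrier : Type
  [isAddCommGroup : AddCommGroup carrier]
  [isModule : Module Λᵐᵒᵖ carrier]
  [isFinite : Module.Finite Λᵐᵒᵖ carrier]

attribute [instance] FinMod.isAddCommGroup FinMod.isModule FinMod.isFinite

variable {Λ}

/-- Two modules are equivalent iff they are isomorphic. -/
def isoSetoid : Setoid (FinMod Λ) where
  r M N := Nonempty (M.carrier ≃ₗ[Λᵐᵒᵖ] N.carrier)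
  iseqv := ⟨fun M => ⟨LinearEquiv.refl _ _⟩, fun ⟨e⟩ => ⟨e.symm⟩, fun ⟨e⟩ ⟨f⟩ => ⟨e.trans f⟩⟩

variable (Λ) in
/-- Isomorphism classes of finitely generated right `Λ`-modules. -/
def IsoCls := Quotient (isoSetoid (Λ := Λ))

/-- `a_M = |Aut_Λ(M)|`. -/
noncomputable def aut (M : FinMod Λ) : ℕ := Nat.card (M.carrier ≃ₗ[Λᵐᵒᵖ] M.carrier)

/-- The Hall number `g^L_{MN}`: the number of `Λ`-submodules `L' ⊆ L` with
`L' ≅ N` and `L/L' ≅ M`. -/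
noncomputable def hallNum (L M N : FinMod Λ) : ℕ :=
  Nat.card {L' : Submodule Λᵐᵒᵖ L.carrier //
    Nonempty ((L.carrier ⧸ L') ≃ₗ[Λᵐᵒᵖ] M.carrier) ∧ Nonempty (L' ≃ₗ[Λᵐᵒᵖ] N.carrier)}

/-- Ext groups of the abelian category of `Λᵐᵒᵖ`-modules exist. -/
instance : HasExt.{1} (ModuleCat.{0} Λᵐᵒᵖ) :=
  letI := HasDerivedCategory.standard (ModuleCat.{0} Λᵐᵒᵖ)
  hasExt_of_hasDerivedCategory _

/-- The Euler form `⟨M,N⟩ = dim_{𝔽_q} Hom_Λ(M,N) - dim_{𝔽_q} Ext¹_Λ(M,N)`, the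
dimension of a finite `𝔽_q`-vector space `W` being computed as `log_q |W|`. -/
noncomputable def euler (q : ℕ) (M N : FinMod Λ) : ℤ :=
  (Nat.log q (Nat.card (M.carrier →ₗ[Λᵐᵒᵖ] N.carrier)) : ℤ) -
    (Nat.log q (Nat.card (Abelian.Ext.{1}
      (ModuleCat.of Λᵐᵒᵖ M.carrier) (ModuleCat.of Λᵐᵒᵖ N.carrier) 1)) : ℤ)

section Euler

instance finite_linearMap {R A B : Type*} [Semiring R] [AddCommMonoid A] [AddCommMonoid B]
    [Module R A] [Module R B] [Finite A] [Finite B] : Finite (A →ₗ[R] B) :=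
  DFunLike.finite _

instance finite_linearEquiv {R A B : Type*} [Semiring R] [AddCommMonoid A] [AddCommMonoid B]
    [Module R A] [Module R B] [Finite A] [Finite B] : Finite (A ≃ₗ[R] B) :=
  DFunLike.finite _

instance finite_quotient {R A : Type*} [Ring R] [AddCommGroup A] [Module R A] [Finite A]
    (U : Submodule R A) : Finite (A ⧸ U) :=
  Finite.of_surjective _ U.mkQ_surjective

/-- The order of `Hom_R(A, Y)` is a power of the order of the ground field. -/
theorem exists_card_linearMap_eq_pow (F : Type*) [Field F] [Finite F] {R A Y : Type*} [Ring R]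
    [Algebra F R] [AddCommGroup A] [AddCommGroup Y] [Module R A] [Module R Y]
    [Finite A] [Finite Y] : ∃ k, Nat.card (A →ₗ[R] Y) = Nat.card F ^ k := by
  let _ : Module F Y := Module.compHom Y (algebraMap F R)
  have : IsScalarTower F R Y := ⟨fun a b y => by
    rw [Algebra.smul_def, mul_smul]; rfl⟩
  have : SMulCommClass R F Y := IsScalarTower.to_smulCommClass'
  exact ⟨_, Module.natCard_eq_pow_finrank⟩

theorem card_mul_card_of_exact {A B C : Type*} [AddCommGroup A] [AddCommGroup B] [AddCommGroup C]
    (f : A →+ B) (g : B →+ C) (hfg : Function.Exact f g) (hg : Function.Surjective g) :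
    Nat.card A * Nat.card C = Nat.card f.ker * Nat.card B := by
  have h1 := f.ker.card_mul_index
  have h2 := g.ker.card_mul_index
  rw [AddSubgroup.index_ker] at h1 h2
  have h3 : g.ker = f.range := AddMonoidHom.exact_iff.mp hfg
  have h4 : Nat.card g.range = Nat.card C := by
    rw [AddMonoidHom.range_eq_top.mpr hg]
    exact Nat.card_congr AddSubgroup.topEquiv.toEquiv
  rw [← h1, ← h2, h3, h4]
  ring

open Abelian in
/-- The long exact sequence of a projective presentation of length one, counted. -/
theorem card_hom_mul_card_ext {R : Type} [Ring R] [HasExt.{1} (ModuleCat.{0} R)] {P X Y : Type}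
    [AddCommGroup P] [AddCommGroup X] [AddCommGroup Y] [Module R P] [Module R X] [Module R Y]
    [Module.Projective R P] (f : P →ₗ[R] X) (hf : Function.Surjective f) :
    Nat.card (P →ₗ[R] Y) * Nat.card (Ext.{1} (ModuleCat.of R X) (ModuleCat.of R Y) 1) =
      Nat.card (X →ₗ[R] Y) * Nat.card (LinearMap.ker f →ₗ[R] Y) := by
  let S : ShortComplex (ModuleCat.{0} R) :=
    ShortComplex.mk (ModuleCat.ofHom (LinearMap.ker f).subtype) (ModuleCat.ofHom f) (by
      ext x; exact x.2)
  have hS : S.ShortExact := by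
    have : Mono S.f := (ModuleCat.mono_iff_injective _).2 (LinearMap.ker f).injective_subtype
    have : Epi S.g := (ModuleCat.epi_iff_surjective _).2 hf
    refine ShortComplex.ShortExact.mk ?_
    rw [ShortComplex.ShortExact.moduleCat_exact_iff_function_exact]
    exact LinearMap.exact_subtype_ker_map f
  let Y' := ModuleCat.of R Y
  have : Projective S.X₂ := (IsProjective.iff_projective P).1 inferInstance
  let r : (P →ₗ[R] Y) →+ (LinearMap.ker f →ₗ[R] Y) :=
    { toFun := fun g => g ∘ₗ (LinearMap.ker f).subtype
      map_zero' := by ext; rfl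
      map_add' := fun _ _ => by ext; rfl }
  let e : (LinearMap.ker f →ₗ[R] Y) ≃+ Ext.{1} S.X₁ Y' 0 :=
    (ModuleCat.homAddEquiv (M := S.X₁) (N := Y')).symm.trans Ext.addEquiv₀.symm
  let e₂ : (P →ₗ[R] Y) ≃+ Ext.{1} S.X₂ Y' 0 :=
    (ModuleCat.homAddEquiv (M := S.X₂) (N := Y')).symm.trans Ext.addEquiv₀.symm
  let d : (LinearMap.ker f →ₗ[R] Y) →+ Ext.{1} S.X₃ Y' 1 :=
    (hS.extClass.precomp Y' (show 1 + 0 = 1 from rfl)).comp e.toAddMonoidHom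
  have he (g : P →ₗ[R] Y) : e (r g) = (Ext.mk₀ S.f).comp (e₂ g) (zero_add 0) := by
    change Ext.mk₀ _ = (Ext.mk₀ S.f).comp (Ext.mk₀ _) _
    rw [Ext.mk₀_comp_mk₀]
    rfl
  have hd : Function.Surjective d := by
    intro x
    obtain ⟨y, hy⟩ := Ext.contravariant_sequence_exact₃ hS Y' x (Ext.eq_zero_of_projective _)
      (show 1 + 0 = 1 from rfl)
    refine ⟨e.symm y, ?_⟩
    change hS.extClass.comp (e (e.symm y)) (show 1 + 0 = 1 from rfl) = x
    rw [e.apply_symm_apply, hy]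
  have hrd : Function.Exact r d := by
    intro x
    constructor
    · intro hx
      obtain ⟨y, hy⟩ := Ext.contravariant_sequence_exact₁ hS Y' (e x) (show 1 + 0 = 1 from rfl) hx
      refine ⟨e₂.symm y, e.injective ?_⟩
      rw [he, e₂.apply_symm_apply, hy]
    · rintro ⟨g, rfl⟩
      change hS.extClass.comp (e (r g)) (show 1 + 0 = 1 from rfl) = 0
      rw [he]
      simp
  have hker : Nat.card r.ker = Nat.card (X →ₗ[R] Y) := by
    symm
    refine Nat.card_congr (Equiv.ofBijective (fun g => ⟨g ∘ₗ f, ?_⟩) ⟨?_, ?_⟩)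
    · ext x
      change g (f x) = 0
      rw [LinearMap.mem_ker.1 x.2, map_zero]
    · intro g g' h
      have h' : g ∘ₗ f = g' ∘ₗ f := congrArg Subtype.val h
      exact LinearMap.ext fun x => by
        obtain ⟨p, rfl⟩ := hf x
        exact LinearMap.congr_fun h' p
    · rintro ⟨g, hg⟩
      have hg' : LinearMap.ker f ≤ LinearMap.ker g := fun x hx =>
        LinearMap.congr_fun (AddMonoidHom.mem_ker.1 hg) ⟨x, hx⟩
      refine ⟨(LinearMap.ker f).liftQ g hg' ∘ₗ (f.quotKerEquivOfSurjective hf).symm, ?_⟩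
      ext x
      change (LinearMap.ker f).liftQ g hg' ((f.quotKerEquivOfSurjective hf).symm (f x)) = g x
      have : f x = f.quotKerEquivOfSurjective hf (Submodule.Quotient.mk x) := rfl
      rw [this, LinearEquiv.symm_apply_apply]
      rfl
  rw [← hker]
  exact card_mul_card_of_exact r d hrd hd

theorem pow_neg_euler (F : Type) [Field F] [Finite F] [Algebra F Λ] (X Y : FinMod Λ)
    [Finite X.carrier] [Finite Y.carrier] {P : Type} [AddCommGroup P] [Module Λᵐᵒᵖ P]
    [Finite P] [Module.Projective Λᵐᵒᵖ P] (f : P →ₗ[Λᵐᵒᵖ] X.carrier)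
    (hf : Function.Surjective f) :
    (Nat.card F : ℚ) ^ (-(euler (Nat.card F) X Y)) * Nat.card (P →ₗ[Λᵐᵒᵖ] Y.carrier) =
      Nat.card (LinearMap.ker f →ₗ[Λᵐᵒᵖ] Y.carrier) := by
  have hF : 1 < Nat.card F := Finite.one_lt_card
  obtain ⟨a, ha⟩ := exists_card_linearMap_eq_pow F (R := Λᵐᵒᵖ) (A := X.carrier) (Y := Y.carrier)
  obtain ⟨b, hb⟩ := exists_card_linearMap_eq_pow F (R := Λᵐᵒᵖ) (A := P) (Y := Y.carrier)
  obtain ⟨c, hc⟩ :=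
    exists_card_linearMap_eq_pow F (R := Λᵐᵒᵖ) (A := LinearMap.ker f) (Y := Y.carrier)
  have h := card_hom_mul_card_ext (Y := Y.carrier) f hf
  rw [ha, hb, hc, ← pow_add] at h
  obtain ⟨d, hd⟩ : ∃ d, Nat.card (Abelian.Ext.{1} (ModuleCat.of Λᵐᵒᵖ X.carrier)
      (ModuleCat.of Λᵐᵒᵖ Y.carrier) 1) = Nat.card F ^ d := by
    have h1 : b ≤ a + c := (Nat.pow_dvd_pow_iff_le_right hF).1 ⟨_, h.symm⟩
    refine ⟨a + c - b, ?_⟩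
    apply Nat.eq_of_mul_eq_mul_left (pow_pos (zero_lt_one.trans hF) b)
    rw [h, ← pow_add, Nat.add_sub_cancel' h1]
  rw [hd, ← pow_add] at h
  have h2 := Nat.pow_right_injective hF h
  have hF0 : (Nat.card F : ℚ) ≠ 0 := by exact_mod_cast (zero_lt_one.trans hF).ne'
  rw [euler, ha, hd, hb, hc, Nat.log_pow hF, Nat.log_pow hF]
  push_cast
  rw [← zpow_natCast, ← zpow_natCast, ← zpow_add₀ hF0]
  congr 1
  have h3 : b + d = a + c := h2
  omega

end Euler

section Counting

variable {R : Type*} [Ring R]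
variable {A B C : Type*} [AddCommGroup A] [AddCommGroup B] [AddCommGroup C]
variable [Module R A] [Module R B] [Module R C]

theorem card_lifts [Module.Projective R A] (g : B →ₗ[R] C) (t : A →ₗ[R] C)
    (h : ∀ x, t x ∈ LinearMap.range g) :
    Nat.card {s : A →ₗ[R] B // g ∘ₗ s = t} = Nat.card (A →ₗ[R] LinearMap.ker g) := by
  obtain ⟨s₀, hs₀⟩ := Module.projective_lifting_property g.rangeRestrict
    (t.codRestrict (LinearMap.range g) h) g.surjective_rangeRestrict
  have hs (x : A) : g (s₀ x) = t x := congrArg Subtype.val (LinearMap.congr_fun hs₀ x)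
  symm
  refine Nat.card_congr (Equiv.ofBijective
    (fun k => ⟨s₀ + (LinearMap.ker g).subtype ∘ₗ k, ?_⟩) ⟨?_, ?_⟩)
  · ext x
    simp [hs]
  · intro k k' hk
    ext x
    simpa using LinearMap.congr_fun (congrArg Subtype.val hk) x
  · rintro ⟨s, hs'⟩
    refine ⟨(s - s₀).codRestrict (LinearMap.ker g) fun x => ?_, ?_⟩
    · simp [hs, ← hs']
    · ext x
      simp

theorem card_linearEquiv_congr {A' B' : Type*} [AddCommGroup A'] [AddCommGroup B'] [Module R A']
    [Module R B'] (e : A ≃ₗ[R] A') (f : B ≃ₗ[R] B') :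
    Nat.card (A ≃ₗ[R] B) = Nat.card (A' ≃ₗ[R] B') :=
  Nat.card_congr
    { toFun := fun g => e.symm.trans (g.trans f)
      invFun := fun g => e.trans (g.trans f.symm)
      left_inv := fun g => by ext; simp
      right_inv := fun g => by ext; simp }

theorem card_linearMap_congr {A' B' : Type*} [AddCommGroup A'] [AddCommGroup B'] [Module R A']
    [Module R B'] (e : A ≃ₗ[R] A') (f : B ≃ₗ[R] B') :
    Nat.card (A →ₗ[R] B) = Nat.card (A' →ₗ[R] B') :=
  Nat.card_congr
    { toFun := fun g => f ∘ₗ g ∘ₗ e.symm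
      invFun := fun g => f.symm ∘ₗ g ∘ₗ e
      left_inv := fun g => by ext; simp
      right_inv := fun g => by ext; simp }

theorem card_sigma_eq_mul {ι : Type*} [Finite ι] {β : ι → Type*} [∀ i, Finite (β i)] (n : ℕ)
    (h : ∀ i, Nat.card (β i) = n) : Nat.card (Σ i, β i) = Nat.card ι * n := by
  have := Fintype.ofFinite ι
  simp [Nat.card_sigma, h]

/-- Two surjections with the same kernel differ by an isomorphism of their targets. -/
theorem exists_equiv_of_ker_eq (f : A →ₗ[R] B) (g : A →ₗ[R] C) (hf : Function.Surjective f)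
    (hg : Function.Surjective g) (h : LinearMap.ker f = LinearMap.ker g) :
    ∃ e : B ≃ₗ[R] C, ∀ x, e (f x) = g x := by
  refine ⟨(f.quotKerEquivOfSurjective hf).symm.trans
    ((Submodule.quotEquivOfEq _ _ h).trans (g.quotKerEquivOfSurjective hg)), fun x => ?_⟩
  have : f x = f.quotKerEquivOfSurjective hf (Submodule.Quotient.mk x) := rfl
  rw [this, LinearEquiv.trans_apply, LinearEquiv.symm_apply_apply]
  rfl

/-- Two injections with the same range differ by an isomorphism of their sources. -/
theorem exists_equiv_of_range_eq (f : A →ₗ[R] C) (g : B →ₗ[R] C) (hf : Function.Injective f)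
    (hg : Function.Injective g) (h : LinearMap.range f = LinearMap.range g) :
    ∃ e : A ≃ₗ[R] B, ∀ x, g (e x) = f x := by
  refine ⟨(LinearEquiv.ofInjective f hf).trans
    ((LinearEquiv.ofEq _ _ h).trans (LinearEquiv.ofInjective g hg).symm), fun x => ?_⟩
  have := congrArg Subtype.val ((LinearEquiv.ofInjective g hg).apply_symm_apply
    (LinearEquiv.ofEq _ _ h (LinearEquiv.ofInjective f hf x)))
  exact this

/-- Linear maps with prescribed kernel, image and cokernel up to isomorphism. -/
theorem card_linearMap_of_shape [Finite A] [Finite B] (p : Submodule R B → Prop)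
    (r : Submodule R A → Prop) (X : Type*) [AddCommGroup X] [Module R X] :
    Nat.card {u : A →ₗ[R] B // p (LinearMap.range u) ∧ r (LinearMap.ker u) ∧
        Nonempty (LinearMap.range u ≃ₗ[R] X)} =
      Nat.card {V : Submodule R B // p V ∧ Nonempty (V ≃ₗ[R] X)} *
      Nat.card {U : Submodule R A // Nonempty ((A ⧸ U) ≃ₗ[R] X) ∧ r U} *
      Nat.card (X ≃ₗ[R] X) := by
  rw [← Nat.card_prod]
  have hfin (i : {V : Submodule R B // p V ∧ Nonempty (V ≃ₗ[R] X)} ×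
      {U : Submodule R A // Nonempty ((A ⧸ U) ≃ₗ[R] X) ∧ r U}) :
      Nat.card ((A ⧸ i.2.1) ≃ₗ[R] i.1.1) = Nat.card (X ≃ₗ[R] X) :=
    card_linearEquiv_congr i.2.2.1.some i.1.2.2.some
  rw [← card_sigma_eq_mul _ hfin]
  symm
  have hr (U : Submodule R A) (V : Submodule R B) (e : (A ⧸ U) ≃ₗ[R] V) :
      LinearMap.range (V.subtype ∘ₗ e.toLinearMap ∘ₗ U.mkQ) = V := by
    rw [LinearMap.range_comp, LinearMap.range_comp]
    simp
  have hk (U : Submodule R A) (V : Submodule R B) (e : (A ⧸ U) ≃ₗ[R] V) :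
      LinearMap.ker (V.subtype ∘ₗ e.toLinearMap ∘ₗ U.mkQ) = U := by
    rw [LinearMap.ker_comp, Submodule.ker_subtype, Submodule.comap_bot, LinearEquiv.ker_comp,
      Submodule.ker_mkQ]
  refine Nat.card_congr (Equiv.ofBijective
    (fun x => ⟨x.1.1.1.subtype ∘ₗ x.2.toLinearMap ∘ₗ x.1.2.1.mkQ, ?_, ?_, ?_⟩) ⟨?_, ?_⟩)
  · rw [hr]; exact x.1.1.2.1
  · rw [hk]; exact x.1.2.2.2
  · rw [hr]; exact x.1.1.2.2
  · rintro ⟨⟨⟨V, hV⟩, ⟨U, hU⟩⟩, e⟩ ⟨⟨⟨V', hV'⟩, ⟨U', hU'⟩⟩, e'⟩ h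
    have h' := congrArg Subtype.val h
    obtain rfl : V = V' := by rw [← hr U V e, ← hr U' V' e']; exact congrArg _ h'
    obtain rfl : U = U' := by rw [← hk U V e, ← hk U' V e']; exact congrArg _ h'
    have : e = e' := by
      ext x
      obtain ⟨x, rfl⟩ := Submodule.mkQ_surjective _ x
      exact LinearMap.congr_fun h' x
    rw [this]
  · rintro ⟨u, h1, h2, ⟨h3⟩⟩
    refine ⟨⟨⟨⟨LinearMap.range u, h1, ⟨h3⟩⟩,
      ⟨LinearMap.ker u, ⟨u.quotKerEquivRange.trans h3⟩, h2⟩⟩, u.quotKerEquivRange⟩, ?_⟩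
    rfl

/-- Short exact sequences `0 → B → C → A → 0`. -/
def SES (R A B C : Type*) [Ring R] [AddCommGroup A] [AddCommGroup B] [AddCommGroup C]
    [Module R A] [Module R B] [Module R C] : Type _ :=
  {x : (B →ₗ[R] C) × (C →ₗ[R] A) // Function.Injective x.1 ∧ Function.Surjective x.2 ∧
    LinearMap.range x.1 = LinearMap.ker x.2}

instance [Finite A] [Finite B] [Finite C] : Finite (SES R A B C) :=
  inferInstanceAs (Finite (Subtype _))

theorem card_SES [Finite A] [Finite B] [Finite C] :
    Nat.card (SES R A B C) = Nat.card {U : Submodule R C //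
      Nonempty ((C ⧸ U) ≃ₗ[R] A) ∧ Nonempty (U ≃ₗ[R] B)} *
      (Nat.card (A ≃ₗ[R] A) * Nat.card (B ≃ₗ[R] B)) := by
  have hfin (U : {U : Submodule R C // Nonempty ((C ⧸ U) ≃ₗ[R] A) ∧ Nonempty (U ≃ₗ[R] B)}) :
      Nat.card (((C ⧸ U.1) ≃ₗ[R] A) × (B ≃ₗ[R] U.1)) =
        Nat.card (A ≃ₗ[R] A) * Nat.card (B ≃ₗ[R] B) := by
    rw [Nat.card_prod, card_linearEquiv_congr U.2.1.some (.refl R A),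
      card_linearEquiv_congr (.refl R B) U.2.2.some]
  rw [← card_sigma_eq_mul _ hfin]
  symm
  refine Nat.card_congr (Equiv.ofBijective (fun x => ⟨(x.1.1.subtype ∘ₗ x.2.2.toLinearMap,
    x.2.1.toLinearMap ∘ₗ x.1.1.mkQ), ?_, ?_, ?_⟩) ⟨?_, ?_⟩)
  · exact x.1.1.injective_subtype.comp x.2.2.injective
  · exact x.2.1.surjective.comp x.1.1.mkQ_surjective
  · simp [LinearMap.range_comp]
  · rintro ⟨⟨U, hU⟩, e, f⟩ ⟨⟨U', hU'⟩, e', f'⟩ h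
    have h1 : U.subtype ∘ₗ f.toLinearMap = U'.subtype ∘ₗ f'.toLinearMap :=
      congrArg Prod.fst (congrArg Subtype.val h)
    have h2 : e.toLinearMap ∘ₗ U.mkQ = e'.toLinearMap ∘ₗ U'.mkQ :=
      congrArg Prod.snd (congrArg Subtype.val h)
    obtain rfl : U = U' := by
      simpa [LinearMap.range_comp] using congrArg LinearMap.range h1
    have he : e = e' := by
      ext x
      obtain ⟨x, rfl⟩ := Submodule.mkQ_surjective _ x
      exact LinearMap.congr_fun h2 x
    have hf : f = f' := by
      ext x
      exact LinearMap.congr_fun h1 x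
    rw [he, hf]
  · rintro ⟨⟨i, p⟩, hi, hp, hip⟩
    let f := LinearEquiv.ofInjective i hi
    let e := (Submodule.quotEquivOfEq _ _ hip).trans (p.quotKerEquivOfSurjective hp)
    exact ⟨⟨⟨LinearMap.range i, ⟨e⟩, ⟨f.symm⟩⟩, e, f⟩, rfl⟩

variable {M N M' N' L P : Type*} [AddCommGroup M] [AddCommGroup N] [AddCommGroup M']
  [AddCommGroup N'] [AddCommGroup L] [AddCommGroup P] [Module R M] [Module R N] [Module R M']
  [Module R N'] [Module R L] [Module R P]

variable (R M N M' N') in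
/-- The data induced by two short exact sequences `0 → N → L → M → 0` and `0 → N' → L → M' → 0`
with the same middle term: the two composites `N' → M` and `N → M'`, together with the
identifications of their cokernels and of their kernels. -/
abbrev Frame : Type _ :=
  Σ (u : N' →ₗ[R] M) (v : N →ₗ[R] M'), ((M ⧸ LinearMap.range u) ≃ₗ[R] (M' ⧸ LinearMap.range v)) ×
    (LinearMap.ker v ≃ₗ[R] LinearMap.ker u)

/-- A pair of short exact sequences with the same middle term induces the given frame. -/
structure Fits (c : SES R M N L × SES R M' N' L) (f : Frame R M N M' N') : Prop where
  left : ∀ y, c.1.1.2 (c.2.1.1 y) = f.1 y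
  right : ∀ y, c.2.1.2 (c.1.1.1 y) = f.2.1 y
  ker : ∀ b : LinearMap.ker f.2.1, c.1.1.1 b = c.2.1.1 (f.2.2.2 b)
  coker : ∀ l, f.2.2.1 (Submodule.Quotient.mk (c.1.1.2 l)) = Submodule.Quotient.mk (c.2.1.2 l)

theorem existsUnique_fits (c : SES R M N L × SES R M' N' L) : ∃! f, Fits c f := by
  obtain ⟨⟨⟨i, p⟩, hi, hp, hip⟩, ⟨⟨i', p'⟩, hi', hp', hip'⟩⟩ := c
  dsimp only at hi hp hip hi' hp' hip'
  have hpi (l : L) : p l = 0 ↔ ∃ n, i n = l := by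
    rw [← LinearMap.mem_ker, ← hip]; rfl
  have hpi' (l : L) : p' l = 0 ↔ ∃ n, i' n = l := by
    rw [← LinearMap.mem_ker, ← hip']; rfl
  let u := p ∘ₗ i'
  let v := p' ∘ₗ i
  obtain ⟨α, hα⟩ := exists_equiv_of_ker_eq ((LinearMap.range u).mkQ ∘ₗ p)
    ((LinearMap.range v).mkQ ∘ₗ p') ((Submodule.mkQ_surjective _).comp hp)
    ((Submodule.mkQ_surjective _).comp hp') (by
      ext l
      simp only [LinearMap.mem_ker, LinearMap.comp_apply, Submodule.mkQ_apply,
        Submodule.Quotient.mk_eq_zero, LinearMap.mem_range, u, v]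
      constructor
      · rintro ⟨y, hy⟩
        obtain ⟨n, hn⟩ := (hpi (l - i' y)).1 (by rw [map_sub, hy, sub_self])
        exact ⟨n, by rw [hn, map_sub, (hpi' (i' y)).2 ⟨y, rfl⟩, sub_zero]⟩
      · rintro ⟨y, hy⟩
        obtain ⟨n, hn⟩ := (hpi' (l - i y)).1 (by rw [map_sub, hy, sub_self])
        exact ⟨n, by rw [hn, map_sub, (hpi (i y)).2 ⟨y, rfl⟩, sub_zero]⟩)
  obtain ⟨δ, hδ⟩ := exists_equiv_of_range_eq (i ∘ₗ (LinearMap.ker v).subtype)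
    (i' ∘ₗ (LinearMap.ker u).subtype) (hi.comp (Submodule.injective_subtype _))
    (hi'.comp (Submodule.injective_subtype _)) (by
      ext l
      constructor
      · rintro ⟨⟨n, hn⟩, rfl⟩
        obtain ⟨n', hn'⟩ := (hpi' (i n)).1 hn
        exact ⟨⟨n', by
          change p (i' n') = 0
          rw [hn']; exact (hpi _).2 ⟨n, rfl⟩⟩, hn'⟩
      · rintro ⟨⟨n, hn⟩, rfl⟩
        obtain ⟨n', hn'⟩ := (hpi (i' n)).1 hn
        exact ⟨⟨n', by
          change p' (i n') = 0
          rw [hn']; exact (hpi' _).2 ⟨n, rfl⟩⟩, hn'⟩)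
  refine ⟨⟨u, v, α, δ⟩, ⟨fun _ => rfl, fun _ => rfl, fun b => (hδ b).symm, hα⟩, ?_⟩
  rintro ⟨u', v', α', δ'⟩ ⟨h1, h2, h3, h4⟩
  obtain rfl : u = u' := LinearMap.ext h1
  obtain rfl : v = v' := LinearMap.ext h2
  have hαα : α' = α := by
    ext x
    obtain ⟨x, rfl⟩ := Submodule.mkQ_surjective _ x
    obtain ⟨l, rfl⟩ := hp x
    exact (h4 l).trans (hα l).symm
  have hδδ : δ' = δ := by
    ext b
    exact hi' ((h3 b).symm.trans (hδ b).symm)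
  rw [hαα, hδδ]

theorem card_SES_mul_card_SES [Finite M] [Finite N] [Finite M'] [Finite N'] [Finite L]
    [Fintype (Frame R M N M' N')] :
    Nat.card (SES R M N L) * Nat.card (SES R M' N' L) =
      ∑ f : Frame R M N M' N', Nat.card {c : SES R M N L × SES R M' N' L // Fits c f} := by
  rw [← Nat.card_prod, ← Nat.card_sigma]
  refine Nat.card_congr (Equiv.ofBijective
    (fun c => ⟨(existsUnique_fits c).choose, c, (existsUnique_fits c).choose_spec.1⟩) ⟨?_, ?_⟩)
  · intro c c' h
    have h' := congrArg (fun x : Σ f, {c : SES R M N L × SES R M' N' L // Fits c f} => x.2.1) h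
    exact h'
  · rintro ⟨f, c, hc⟩
    refine ⟨c, ?_⟩
    have := (existsUnique_fits c).choose_spec.2 f hc
    subst this
    rfl

/-- The kernels of the surjections `N × N' × P → L` attached to pairs of short exact sequences
inducing a given frame and to a lift `P → L` of `τ₁ : P → M` and `τ₂ : P → M'`. -/
structure IsKernel (f : Frame R M N M' N') (τ₁ : P →ₗ[R] M) (τ₂ : P →ₗ[R] M')
    (U : Submodule R (N × N' × P)) : Prop where
  left : ∀ n n' x, (n, n', x) ∈ U → τ₁ x = f.1 n'
  right : ∀ n n' x, (n, n', x) ∈ U → τ₂ x = -f.2.1 n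
  mem_iff : ∀ n n', (n, n', 0) ∈ U ↔ ∃ h : f.2.1 n = 0, n' = f.2.2.2 ⟨n, h⟩
  proj : ∀ x, τ₁ x ∈ LinearMap.range f.1 → ∃ n n', (n, n', x) ∈ U

theorem exists_comp_eq_of_ker_le (h : A →ₗ[R] B) (g : A →ₗ[R] C) (hh : Function.Surjective h)
    (hk : ∀ x, h x = 0 → g x = 0) : ∃ k : B →ₗ[R] C, ∀ x, k (h x) = g x := by
  refine ⟨(LinearMap.ker h).liftQ g hk ∘ₗ (h.quotKerEquivOfSurjective hh).symm, fun x => ?_⟩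
  have : h x = h.quotKerEquivOfSurjective hh (Submodule.Quotient.mk x) := rfl
  rw [LinearMap.comp_apply, this, LinearEquiv.coe_coe, LinearEquiv.symm_apply_apply]
  rfl

theorem card_quotient_equiv [Finite A] [Finite B] (p : Submodule R A → Prop) :
    Nat.card (Σ U : {U : Submodule R A // p U}, ((A ⧸ U.1) ≃ₗ[R] B)) =
      Nat.card {h : A →ₗ[R] B // Function.Surjective h ∧ p (LinearMap.ker h)} := by
  have hk (U : Submodule R A) (e : (A ⧸ U) ≃ₗ[R] B) :
      LinearMap.ker (e.toLinearMap ∘ₗ U.mkQ) = U := by simp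
  refine Nat.card_congr (Equiv.ofBijective
    (fun x => ⟨x.2.toLinearMap ∘ₗ x.1.1.mkQ, ?_, ?_⟩) ⟨?_, ?_⟩)
  · exact x.2.surjective.comp x.1.1.mkQ_surjective
  · rw [hk]; exact x.1.2
  · rintro ⟨⟨U, hU⟩, e⟩ ⟨⟨U', hU'⟩, e'⟩ h
    have h' : e.toLinearMap ∘ₗ U.mkQ = e'.toLinearMap ∘ₗ U'.mkQ := congrArg Subtype.val h
    obtain rfl : U = U' := by rw [← hk U e, ← hk U' e', h']
    have : e = e' := by
      ext x
      obtain ⟨x, rfl⟩ := Submodule.mkQ_surjective _ x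
      exact LinearMap.congr_fun h' x
    rw [this]
  · rintro ⟨h, hs, hp⟩
    exact ⟨⟨⟨LinearMap.ker h, hp⟩, h.quotKerEquivOfSurjective hs⟩, rfl⟩

theorem card_lifts_of_fits [Module.Projective R P] {f : Frame R M N M' N'} {τ₁ : P →ₗ[R] M}
    {τ₂ : P →ₗ[R] M'}
    (hτ : ∀ x, f.2.2.1 (Submodule.Quotient.mk (τ₁ x)) = Submodule.Quotient.mk (τ₂ x))
    (c : SES R M N L × SES R M' N' L) (hc : Fits c f) :
    Nat.card {φ : P →ₗ[R] L // (∀ x, c.1.1.2 (φ x) = τ₁ x) ∧ ∀ x, c.2.1.2 (φ x) = τ₂ x} =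
      Nat.card (P →ₗ[R] LinearMap.ker f.2.1) := by
  obtain ⟨⟨⟨i, p⟩, hi, hp, hip⟩, ⟨⟨i', p'⟩, hi', hp', hip'⟩⟩ := c
  obtain ⟨u, v, α, δ⟩ := f
  obtain ⟨h1, h2, h3, h4⟩ := hc
  dsimp only at *
  have hpi (l : L) : p l = 0 ↔ ∃ n, i n = l := by
    rw [← LinearMap.mem_ker, ← hip]; rfl
  have hpi' (l : L) : p' l = 0 ↔ ∃ n, i' n = l := by
    rw [← LinearMap.mem_ker, ← hip']; rfl
  obtain ⟨e, -⟩ := exists_equiv_of_range_eq (i ∘ₗ (LinearMap.ker v).subtype)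
    (LinearMap.ker (p.prod p')).subtype (hi.comp (Submodule.injective_subtype _))
    (Submodule.injective_subtype _) (by
      rw [Submodule.range_subtype]
      ext l
      rw [LinearMap.mem_ker, show p.prod p' l = (p l, p' l) from rfl, Prod.mk_eq_zero]
      constructor
      · rintro ⟨⟨n, hn⟩, rfl⟩
        exact ⟨(hpi _).2 ⟨n, rfl⟩, (h2 n).trans hn⟩
      · rintro ⟨hl, hl'⟩
        obtain ⟨n, rfl⟩ := (hpi l).1 hl
        exact ⟨⟨n, (h2 n).symm.trans hl'⟩, rfl⟩)
  rw [card_linearMap_congr (LinearEquiv.refl R P) e, ← card_lifts (p.prod p') (τ₁.prod τ₂)]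
  · refine Nat.card_congr (Equiv.subtypeEquivRight fun φ => ?_)
    simp [LinearMap.ext_iff, forall_and]
  · intro x
    obtain ⟨l, hl⟩ := hp (τ₁ x)
    have h := h4 l
    rw [hl, hτ, Submodule.Quotient.eq] at h
    obtain ⟨n, hn⟩ := h
    refine ⟨l + i n, ?_⟩
    refine Prod.ext ?_ ?_
    · change p (l + i n) = τ₁ x
      rw [map_add, hl, (hpi (i n)).2 ⟨n, rfl⟩, add_zero]
    · change p' (l + i n) = τ₂ x
      rw [map_add, h2, hn, add_sub_cancel]

theorem isKernel_of_fits {f : Frame R M N M' N'} {τ₁ : P →ₗ[R] M} {τ₂ : P →ₗ[R] M'}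
    (hτ₁ : Function.Surjective τ₁)
    {c : SES R M N L × SES R M' N' L} (hc : Fits c f) {φ : P →ₗ[R] L}
    (hφ : ∀ x, c.1.1.2 (φ x) = τ₁ x) (hφ' : ∀ x, c.2.1.2 (φ x) = τ₂ x) :
    Function.Surjective (c.1.1.1.coprod ((-c.2.1.1).coprod φ)) ∧
      IsKernel f τ₁ τ₂ (LinearMap.ker (c.1.1.1.coprod ((-c.2.1.1).coprod φ))) := by
  obtain ⟨⟨⟨i, p⟩, hi, hp, hip⟩, ⟨⟨i', p'⟩, hi', hp', hip'⟩⟩ := c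
  obtain ⟨h1, h2, h3, h4⟩ := hc
  obtain ⟨u, v, α, δ⟩ := f
  dsimp only at *
  have hpi (l : L) : p l = 0 ↔ ∃ n, i n = l := by
    rw [← LinearMap.mem_ker, ← hip]; rfl
  have hpi' (l : L) : p' l = 0 ↔ ∃ n, i' n = l := by
    rw [← LinearMap.mem_ker, ← hip']; rfl
  have hp0 (n : N) : p (i n) = 0 := (hpi _).2 ⟨n, rfl⟩
  have hp0' (n : N') : p' (i' n) = 0 := (hpi' _).2 ⟨n, rfl⟩
  have hker (n n' x) : (n, n', x) ∈ LinearMap.ker (i.coprod ((-i').coprod φ)) ↔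
      i n - i' n' + φ x = 0 := by
    simp [sub_eq_add_neg, add_assoc]
  refine ⟨fun l => ?_, ?_, ?_, ?_, ?_⟩
  · obtain ⟨x, hx⟩ := hτ₁ (p l)
    obtain ⟨n, hn⟩ := (hpi (l - φ x)).1 (by rw [map_sub, hφ, hx, sub_self])
    exact ⟨(n, 0, x), by simp [hn]⟩
  · intro n n' x hx
    have := congrArg p ((hker _ _ _).1 hx)
    simp only [map_add, map_sub, hp0, h1, hφ, map_zero, zero_sub] at this
    exact (neg_add_eq_zero.1 this).symm
  · intro n n' x hx
    have := congrArg p' ((hker _ _ _).1 hx)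
    simp only [map_add, map_sub, hp0', h2, hφ', map_zero, sub_zero] at this
    exact (neg_eq_of_add_eq_zero_right this).symm
  · intro n n'
    rw [hker, map_zero, add_zero, sub_eq_zero]
    constructor
    · intro h
      have hn : v n = 0 := by rw [← h2, h, hp0']
      exact ⟨hn, hi' (h.symm.trans (h3 ⟨n, hn⟩))⟩
    · rintro ⟨hn, rfl⟩
      exact h3 ⟨n, hn⟩
  · rintro x ⟨n', hn'⟩
    obtain ⟨n, hn⟩ := (hpi (i' n' - φ x)).1 (by rw [map_sub, hφ, h1, hn', sub_self])
    exact ⟨n, n', (hker _ _ _).2 (by rw [hn]; abel)⟩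

theorem eq_of_fits_of_coprod_eq {f : Frame R M N M' N'} {τ₁ : P →ₗ[R] M} {τ₂ : P →ₗ[R] M'}
    (hτ₁ : Function.Surjective τ₁)
    {c d : SES R M N L × SES R M' N' L} (hc : Fits c f) (hd : Fits d f) {φ ψ : P →ₗ[R] L}
    (hφ : ∀ x, c.1.1.2 (φ x) = τ₁ x) (hφ' : ∀ x, c.2.1.2 (φ x) = τ₂ x)
    (hψ : ∀ x, d.1.1.2 (ψ x) = τ₁ x) (hψ' : ∀ x, d.2.1.2 (ψ x) = τ₂ x)
    (h' : c.1.1.1.coprod ((-c.2.1.1).coprod φ) = d.1.1.1.coprod ((-d.2.1.1).coprod ψ)) :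
    c = d ∧ φ = ψ := by
  obtain ⟨⟨⟨i, p⟩, hi⟩, ⟨⟨i', p'⟩, hi'⟩⟩ := c
  obtain ⟨⟨⟨j, r⟩, hj⟩, ⟨⟨j', r'⟩, hj'⟩⟩ := d
  obtain ⟨h1, h2, h3, h4⟩ := hc
  obtain ⟨k1, k2, k3, k4⟩ := hd
  obtain rfl : i = j := by
    ext x
    simpa using LinearMap.congr_fun h' (x, 0, 0)
  obtain rfl : i' = j' := by
    ext x
    simpa using LinearMap.congr_fun h' (0, x, 0)
  obtain rfl : φ = ψ := by
    ext x
    simpa using LinearMap.congr_fun h' (0, 0, x)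
  dsimp only at *
  have hpi (l : L) : p l = 0 ↔ ∃ n, i n = l := by
    rw [← LinearMap.mem_ker, ← hi.2.2]; rfl
  have hri (l : L) : r l = 0 ↔ ∃ n, i n = l := by
    rw [← LinearMap.mem_ker, ← hj.2.2]; rfl
  have hpi' (l : L) : p' l = 0 ↔ ∃ n, i' n = l := by
    rw [← LinearMap.mem_ker, ← hi'.2.2]; rfl
  have hs (l : L) : ∃ n x, l = i n + φ x := by
    obtain ⟨x, hx⟩ := hτ₁ (p l)
    obtain ⟨n, hn⟩ := (hpi (l - φ x)).1 (by rw [map_sub, hφ, hx, sub_self])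
    exact ⟨n, x, by rw [hn]; abel⟩
  obtain rfl : p = r := by
    ext l
    obtain ⟨n, x, rfl⟩ := hs l
    rw [map_add, map_add, (hpi _).2 ⟨n, rfl⟩, (hri _).2 ⟨n, rfl⟩, hφ, hψ]
  obtain rfl : p' = r' := by
    ext l
    obtain ⟨n, x, rfl⟩ := hs l
    rw [map_add, map_add, h2, k2, hφ', hψ']
  exact ⟨rfl, rfl⟩

theorem exists_fits_of_isKernel {f : Frame R M N M' N'} {τ₁ : P →ₗ[R] M} {τ₂ : P →ₗ[R] M'}
    (hτ₁ : Function.Surjective τ₁)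
    (hτ : ∀ x, f.2.2.1 (Submodule.Quotient.mk (τ₁ x)) = Submodule.Quotient.mk (τ₂ x))
    {h : N × N' × P →ₗ[R] L} (hs : Function.Surjective h)
    (hU : IsKernel f τ₁ τ₂ (LinearMap.ker h)) :
    ∃ (c : SES R M N L × SES R M' N' L) (φ : P →ₗ[R] L), Fits c f ∧
      (∀ x, c.1.1.2 (φ x) = τ₁ x) ∧ (∀ x, c.2.1.2 (φ x) = τ₂ x) ∧
      c.1.1.1.coprod ((-c.2.1.1).coprod φ) = h := by
  have hu (y : N') : (Submodule.Quotient.mk (f.1 y) : M ⧸ LinearMap.range f.1) = 0 :=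
    (Submodule.Quotient.mk_eq_zero _).2 ⟨y, rfl⟩
  have hv (y : N) : (Submodule.Quotient.mk (f.2.1 y) : M' ⧸ LinearMap.range f.2.1) = 0 :=
    (Submodule.Quotient.mk_eq_zero _).2 ⟨y, rfl⟩
  obtain ⟨u, v, α, δ⟩ := f
  obtain ⟨hU1, hU2, hU3, hU4⟩ := hU
  dsimp only at *
  have hα (m : M) (m' : M') : α (Submodule.Quotient.mk m) = Submodule.Quotient.mk m' →
      (m ∈ LinearMap.range u ↔ m' ∈ LinearMap.range v) := by
    intro h
    rw [← Submodule.Quotient.mk_eq_zero, ← Submodule.Quotient.mk_eq_zero (LinearMap.range v),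
      ← h, LinearEquiv.map_eq_zero_iff]
  obtain ⟨p, hp⟩ := exists_comp_eq_of_ker_le h
    (LinearMap.coprod 0 ((-u).coprod τ₁) : N × N' × P →ₗ[R] M) hs (by
      rintro ⟨n, n', x⟩ hx
      simp [hU1 n n' x hx])
  obtain ⟨p', hp'⟩ := exists_comp_eq_of_ker_le h
    (v.coprod (LinearMap.coprod 0 τ₂) : N × N' × P →ₗ[R] M') hs (by
      rintro ⟨n, n', x⟩ hx
      simp [hU2 n n' x hx])
  have hp (n n' x) : p (h (n, n', x)) = τ₁ x - u n' := by
    rw [hp]; simp [neg_add_eq_sub]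
  have hp' (n n' x) : p' (h (n, n', x)) = v n + τ₂ x := by
    rw [hp']; simp
  let i : N →ₗ[R] L := h ∘ₗ LinearMap.inl R N (N' × P)
  let i' : N' →ₗ[R] L := -(h ∘ₗ LinearMap.inr R N (N' × P) ∘ₗ LinearMap.inl R N' P)
  let φ : P →ₗ[R] L := h ∘ₗ LinearMap.inr R N (N' × P) ∘ₗ LinearMap.inr R N' P
  have hi (n) : i n = h (n, 0, 0) := rfl
  have hi' (n) : i' n = -h (0, n, 0) := rfl
  have hφ (n) : φ n = h (0, 0, n) := rfl
  have hi'2 (n) : i' n = h (0, -n, 0) := by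
    rw [hi', ← map_neg]; simp
  have hsub (w w') (hw : w - w' ∈ LinearMap.ker h) : h w = h w' := by
    rw [← sub_eq_zero, ← map_sub]; exact hw
  refine ⟨⟨⟨⟨i, p⟩, ?_, ?_, ?_⟩, ⟨⟨i', p'⟩, ?_, ?_, ?_⟩⟩, φ, ⟨?_, ?_, ?_, ?_⟩, ?_, ?_, ?_⟩
  · rw [← LinearMap.ker_eq_bot, LinearMap.ker_eq_bot']
    intro n hn
    obtain ⟨h0, h1⟩ := (hU3 n 0).1 hn
    have h2 := δ.map_eq_zero_iff.1 (Subtype.ext h1.symm)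
    exact congrArg Subtype.val h2
  · intro m
    obtain ⟨x, rfl⟩ := hτ₁ m
    exact ⟨h (0, 0, x), by rw [hp]; simp⟩
  · ext l
    constructor
    · rintro ⟨n, rfl⟩
      rw [LinearMap.mem_ker]
      dsimp only
      rw [hi, hp]; simp
    · intro hl
      obtain ⟨⟨n, n', x⟩, rfl⟩ := hs l
      rw [LinearMap.mem_ker] at hl
      dsimp only at hl
      rw [hp, sub_eq_zero] at hl
      obtain ⟨n₁, n₁', hn⟩ := hU4 x ⟨n', hl.symm⟩
      have h0 : u (n' - n₁') = 0 := by rw [map_sub, ← hl, hU1 _ _ _ hn, sub_self]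
      let b := δ.symm ⟨n' - n₁', h0⟩
      have hb : ((b : N), n' - n₁', (0 : P)) ∈ LinearMap.ker h :=
        (hU3 _ _).2 ⟨b.2, by simp [b]⟩
      refine ⟨n - n₁ - b, hsub _ _ ?_⟩
      have := neg_mem (add_mem hn hb)
      convert this using 1
      change (n - n₁ - (b : N), (0 : N'), (0 : P)) - (n, n', x) = _
      simp only [Prod.mk_sub_mk, Prod.mk_add_mk, Prod.neg_mk, Prod.mk.injEq]
      refine ⟨?_, ?_, ?_⟩
      · abel
      · simp
      · simp
  · rw [← LinearMap.ker_eq_bot, LinearMap.ker_eq_bot']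
    intro n hn
    have hn' : h (0, n, 0) = 0 := neg_eq_zero.1 hn
    obtain ⟨h0, h1⟩ := (hU3 0 n).1 hn'
    rw [h1]
    have : (⟨0, h0⟩ : LinearMap.ker v) = 0 := rfl
    rw [this, map_zero]; rfl
  · intro m'
    obtain ⟨m, hm⟩ := Submodule.mkQ_surjective _ (α.symm (Submodule.Quotient.mk m'))
    obtain ⟨x, rfl⟩ := hτ₁ m
    have h1 : α (Submodule.Quotient.mk (τ₁ x)) = Submodule.Quotient.mk m' := by
      rw [← Submodule.mkQ_apply, hm, α.apply_symm_apply]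
    rw [hτ, eq_comm, Submodule.Quotient.eq] at h1
    obtain ⟨n, hn⟩ := h1
    exact ⟨h (n, 0, x), by dsimp only; rw [hp', hn]; simp⟩
  · ext l
    constructor
    · rintro ⟨n, rfl⟩
      rw [LinearMap.mem_ker]
      dsimp only
      rw [hi'2, hp']; simp
    · intro hl
      obtain ⟨⟨n, n', x⟩, rfl⟩ := hs l
      rw [LinearMap.mem_ker] at hl
      dsimp only at hl
      rw [hp'] at hl
      obtain ⟨n₁, n₁', hn⟩ := hU4 x ((hα _ _ (hτ x)).2
        ⟨-n, by rw [map_neg]; exact neg_eq_of_add_eq_zero_right hl⟩)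
      have h0 : v (n - n₁) = 0 := by
        rw [map_sub, eq_neg_of_add_eq_zero_left hl, hU2 _ _ _ hn]; simp
      have hb : (n - n₁, (δ ⟨n - n₁, h0⟩ : N'), (0 : P)) ∈ LinearMap.ker h :=
        (hU3 _ _).2 ⟨h0, rfl⟩
      refine ⟨-(n' - n₁' - δ ⟨n - n₁, h0⟩), ?_⟩
      dsimp only
      rw [hi'2, neg_neg]
      apply hsub
      have := neg_mem (add_mem hn hb)
      convert this using 1
      simp only [Prod.mk_sub_mk, Prod.mk_add_mk, Prod.neg_mk, Prod.mk.injEq]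
      refine ⟨?_, ?_, ?_⟩
      · abel
      · abel
      · simp
  · intro y
    dsimp only
    rw [hi'2, hp]; simp
  · intro y
    dsimp only
    rw [hi, hp']; simp
  · intro b
    dsimp only
    rw [hi, hi'2]
    apply hsub
    have := (hU3 b (δ b)).2 ⟨b.2, rfl⟩
    simpa using this
  · intro l
    obtain ⟨⟨n, n', x⟩, rfl⟩ := hs l
    dsimp only at *
    rw [hp, hp', Submodule.Quotient.mk_sub, Submodule.Quotient.mk_add, hu, hv, sub_zero,
      zero_add, hτ]
  · intro x
    dsimp only
    rw [hφ, hp]; simp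
  · intro x
    dsimp only
    rw [hφ, hp']; simp
  · refine LinearMap.ext fun ⟨n, n', x⟩ => ?_
    simp only [LinearMap.coprod_apply, LinearMap.neg_apply, hi, hi', hφ, neg_neg, ← map_add]
    simp

theorem card_fits_mul [Finite M] [Finite N] [Finite M'] [Finite N'] [Finite L] [Finite P]
    [Module.Projective R P] (f : Frame R M N M' N') (τ₁ : P →ₗ[R] M) (τ₂ : P →ₗ[R] M')
    (hτ₁ : Function.Surjective τ₁)
    (hτ : ∀ x, f.2.2.1 (Submodule.Quotient.mk (τ₁ x)) = Submodule.Quotient.mk (τ₂ x)) :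
    Nat.card {c : SES R M N L × SES R M' N' L // Fits c f} *
        Nat.card (P →ₗ[R] LinearMap.ker f.2.1) =
      Nat.card (Σ U : {U : Submodule R (N × N' × P) // IsKernel f τ₁ τ₂ U},
        (((N × N' × P) ⧸ U.1) ≃ₗ[R] L)) := by
  rw [card_quotient_equiv (IsKernel f τ₁ τ₂), ← card_sigma_eq_mul _
    fun c : {c : SES R M N L × SES R M' N' L // Fits c f} => card_lifts_of_fits hτ c.1 c.2]
  refine Nat.card_congr (Equiv.ofBijective (fun x =>
    ⟨x.1.1.1.1.1.coprod ((-x.1.1.2.1.1).coprod x.2.1),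
      isKernel_of_fits hτ₁ x.1.2 x.2.2.1 x.2.2.2⟩) ⟨?_, ?_⟩)
  · rintro ⟨⟨c, hc⟩, φ, hφ, hφ'⟩ ⟨⟨d, hd⟩, ψ, hψ, hψ'⟩ h
    obtain ⟨rfl, rfl⟩ :=
      eq_of_fits_of_coprod_eq hτ₁ hc hd hφ hφ' hψ hψ' (congrArg Subtype.val h)
    rfl
  · rintro ⟨h, hs, hU⟩
    obtain ⟨c, φ, hc, hφ, hφ', hh⟩ := exists_fits_of_isKernel hτ₁ hτ hs hU
    exact ⟨⟨⟨c, hc⟩, φ, hφ, hφ'⟩, Subtype.ext hh⟩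

theorem card_isKernel (f : Frame R M N M' N') (τ₁ : P →ₗ[R] M) (τ₂ : P →ₗ[R] M')
    (hτ : ∀ x, f.2.2.1 (Submodule.Quotient.mk (τ₁ x)) = Submodule.Quotient.mk (τ₂ x))
    [Module.Projective R (LinearMap.ker ((LinearMap.range f.1).mkQ ∘ₗ τ₁))] :
    Nat.card {U : Submodule R (N × N' × P) // IsKernel f τ₁ τ₂ U} =
      Nat.card (LinearMap.ker ((LinearMap.range f.1).mkQ ∘ₗ τ₁) →ₗ[R] LinearMap.ker f.2.1) := by
  obtain ⟨u, v, α, δ⟩ := f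
  dsimp only at *
  set Ω := LinearMap.ker ((LinearMap.range u).mkQ ∘ₗ τ₁)
  have hΩ (x : P) : x ∈ Ω ↔ τ₁ x ∈ LinearMap.range u := by
    simp [Ω, LinearMap.mem_ker, Submodule.Quotient.mk_eq_zero]
  have hΩ' (x : P) (hx : x ∈ Ω) : τ₂ x ∈ LinearMap.range v := by
    rw [← Submodule.Quotient.mk_eq_zero, ← hτ, LinearEquiv.map_eq_zero_iff,
      Submodule.Quotient.mk_eq_zero, ← hΩ]
    exact hx
  let k : LinearMap.ker v →ₗ[R] N × N' × P :=
    (LinearMap.ker v).subtype.prod (((LinearMap.ker u).subtype ∘ₗ δ.toLinearMap).prod 0)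
  have hk (b) : k b = ((b : N), (δ b : N'), (0 : P)) := rfl
  let K := LinearMap.range k
  have hK (n n' x) : (n, n', x) ∈ K ↔ x = 0 ∧ ∃ h : v n = 0, n' = δ ⟨n, h⟩ := by
    constructor
    · rintro ⟨b, hb⟩
      rw [hk] at hb
      cases hb
      exact ⟨rfl, b.2, rfl⟩
    · rintro ⟨rfl, h, rfl⟩
      exact ⟨⟨n, h⟩, rfl⟩
  let G : N × N' × P →ₗ[R] M × M' × P :=
    (LinearMap.coprod 0 ((-u).coprod τ₁)).prod
      ((v.coprod (LinearMap.coprod 0 τ₂)).prod (LinearMap.snd R N' P ∘ₗ LinearMap.snd R N _))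
  have hG (n n' x) : G (n, n', x) = (τ₁ x - u n', τ₂ x + v n, x) := by
    simp [G, neg_add_eq_sub, add_comm]
  let g : ((N × N' × P) ⧸ K) →ₗ[R] M × M' × P := K.liftQ G (by
    rintro _ ⟨b, rfl⟩
    rw [LinearMap.mem_ker, hk, hG, (δ b).2, b.2]
    simp)
  have hg (w) : g (Submodule.Quotient.mk w) = G w := rfl
  have hGv (n n' x y) (h : G (n, n', x) = (0, 0, y)) : τ₁ x = u n' ∧ τ₂ x = -v n ∧ x = y := by
    rw [hG, Prod.mk.injEq, Prod.mk.injEq, sub_eq_zero, ← eq_neg_iff_add_eq_zero] at h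
    exact h
  let t : Ω →ₗ[R] M × M' × P := LinearMap.prod 0 (LinearMap.prod 0 Ω.subtype)
  have ht (x) : t x = (0, 0, (x : P)) := rfl
  obtain ⟨e, -⟩ := exists_equiv_of_range_eq
    (K.mkQ ∘ₗ LinearMap.inl R N (N' × P) ∘ₗ (LinearMap.ker v).subtype)
    (LinearMap.ker g).subtype (by
      rw [← LinearMap.ker_eq_bot, LinearMap.ker_eq_bot']
      intro b hb
      have hb' : ((b : N), (0 : N'), (0 : P)) ∈ K := (Submodule.Quotient.mk_eq_zero _).1 hb
      obtain ⟨-, h0, h1⟩ := (hK _ _ _).1 hb'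
      exact δ.map_eq_zero_iff.1 (Subtype.ext h1.symm)) (Submodule.injective_subtype _) (by
      rw [Submodule.range_subtype]
      ext w
      constructor
      · rintro ⟨b, rfl⟩
        change G ((b : N), (0 : N'), (0 : P)) = 0
        rw [hG, b.2]
        simp
      · intro hw
        obtain ⟨⟨n, n', x⟩, rfl⟩ := Submodule.mkQ_surjective _ w
        obtain ⟨h1, h2, rfl⟩ := hGv n n' x 0 hw
        rw [map_zero] at h1 h2
        let b := δ.symm ⟨n', h1.symm⟩
        refine ⟨⟨n - b, ?_⟩, ?_⟩
        · rw [LinearMap.mem_ker, map_sub, b.2, ← neg_neg (v n), ← h2]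
          simp
        · refine ((Submodule.Quotient.eq K).2 ?_)
          change (n - (b : N), (0 : N'), (0 : P)) - (n, n', 0) ∈ K
          rw [← neg_mem_iff]
          exact ⟨b, by rw [hk]; simp [b]⟩)
  rw [card_linearMap_congr (LinearEquiv.refl R Ω) e, ← card_lifts g t]
  · symm
    have hs (s : Ω →ₗ[R] (N × N' × P) ⧸ K) (h : g ∘ₗ s = t) (n n' x)
        (hw : (n, n', x) ∈ (LinearMap.range s).comap K.mkQ) :
        ∃ hx : x ∈ Ω, s ⟨x, hx⟩ = Submodule.Quotient.mk (n, n', x) ∧ τ₁ x = u n' ∧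
          τ₂ x = -v n := by
      obtain ⟨y, hy⟩ := hw
      have h1 := LinearMap.congr_fun h y
      rw [LinearMap.comp_apply, hy, ht] at h1
      obtain ⟨h2, h3, rfl⟩ := hGv _ _ _ _ h1
      exact ⟨y.2, hy, h2, h3⟩
    have hs' (s : Ω →ₗ[R] (N × N' × P) ⧸ K) (h : g ∘ₗ s = t) (x : Ω) :
        ∃ n n', s x = Submodule.Quotient.mk (n, n', (x : P)) := by
      obtain ⟨⟨n, n', y⟩, hw⟩ := Submodule.mkQ_surjective _ (s x)
      have h1 := LinearMap.congr_fun h x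
      rw [LinearMap.comp_apply, ← hw, ht] at h1
      obtain ⟨-, -, rfl⟩ := hGv _ _ _ _ h1
      exact ⟨n, n', hw.symm⟩
    refine Nat.card_congr (Equiv.ofBijective
      (fun s => ⟨(LinearMap.range s.1).comap K.mkQ, ?_, ?_, ?_, ?_⟩) ⟨?_, ?_⟩)
    · intro n n' x hw
      obtain ⟨-, -, h, -⟩ := hs s.1 s.2 n n' x hw
      exact h
    · intro n n' x hw
      obtain ⟨-, -, -, h⟩ := hs s.1 s.2 n n' x hw
      exact h
    · intro n n'
      constructor
      · intro hw
        obtain ⟨hx, h, -⟩ := hs s.1 s.2 n n' 0 hw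
        have h0 : (⟨0, hx⟩ : Ω) = 0 := rfl
        rw [h0, map_zero, eq_comm, Submodule.Quotient.mk_eq_zero] at h
        exact ((hK _ _ _).1 h).2
      · intro h
        refine ⟨0, ?_⟩
        rw [map_zero]
        exact ((Submodule.Quotient.mk_eq_zero K).2 ((hK _ _ _).2 ⟨rfl, h⟩)).symm
    · intro x hx
      obtain ⟨n, n', h⟩ := hs' s.1 s.2 ⟨x, (hΩ x).2 hx⟩
      exact ⟨n, n', _, h⟩
    · rintro ⟨s, h⟩ ⟨s', h'⟩ hss
      have hss' : (LinearMap.range s).comap K.mkQ = (LinearMap.range s').comap K.mkQ :=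
        congrArg Subtype.val hss
      apply Subtype.ext
      refine LinearMap.ext fun x => ?_
      obtain ⟨n, n', hx⟩ := hs' s h x
      have hw : (n, n', (x : P)) ∈ (LinearMap.range s').comap K.mkQ := by
        rw [← hss']
        exact ⟨x, hx⟩
      obtain ⟨_, h1, -⟩ := hs s' h' _ _ _ hw
      exact hx.trans h1.symm
    · rintro ⟨U, hU1, hU2, hU3, hU4⟩
      dsimp only at *
      let π : U →ₗ[R] Ω :=
        ((LinearMap.snd R N' P ∘ₗ LinearMap.snd R N (N' × P)) ∘ₗ U.subtype).codRestrict Ω (by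
          rintro ⟨⟨n, n', x⟩, hw⟩
          exact (hΩ x).2 ⟨n', (hU1 n n' x hw).symm⟩)
      obtain ⟨σ, hσ⟩ := Module.projective_lifting_property π LinearMap.id (by
        rintro ⟨x, hx⟩
        obtain ⟨n, n', hw⟩ := hU4 x ((hΩ x).1 hx)
        exact ⟨⟨(n, n', x), hw⟩, rfl⟩)
      have hσ' (x : Ω) : ∃ n n', (σ x : N × N' × P) = (n, n', (x : P)) := by
        have h := congrArg Subtype.val (LinearMap.congr_fun hσ x)
        exact ⟨(σ x : N × N' × P).1, (σ x : N × N' × P).2.1, Prod.ext rfl (Prod.ext rfl h)⟩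
      refine ⟨⟨K.mkQ ∘ₗ U.subtype ∘ₗ σ, ?_⟩, ?_⟩
      · refine LinearMap.ext fun x => ?_
        change G (σ x) = t x
        obtain ⟨n, n', h⟩ := hσ' x
        have hw : (n, n', (x : P)) ∈ U := h ▸ (σ x).2
        rw [h, hG, ht, hU1 _ _ _ hw, hU2 _ _ _ hw]
        simp
      · apply Subtype.ext
        ext ⟨n, n', x⟩
        constructor
        · rintro ⟨y, hy⟩
          have h1 := (Submodule.Quotient.eq K).1 hy
          have h2 : K ≤ U := by
            rintro _ ⟨b, rfl⟩
            exact (hU3 _ _).2 ⟨b.2, rfl⟩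
          have := sub_mem (σ y).2 (h2 h1)
          simpa using this
        · intro hw
          have hx : x ∈ Ω := (hΩ x).2 ⟨n', (hU1 n n' x hw).symm⟩
          obtain ⟨m, m', h⟩ := hσ' ⟨x, hx⟩
          refine ⟨⟨x, hx⟩, (Submodule.Quotient.eq K).2 ?_⟩
          have h1 := sub_mem (σ ⟨x, hx⟩).2 hw
          change (σ ⟨x, hx⟩ : N × N' × P) - (n, n', x) ∈ K
          rw [h, Prod.mk_sub_mk, Prod.mk_sub_mk, sub_self] at h1 ⊢
          exact (hK _ _ _).2 ⟨rfl, (hU3 _ _).1 h1⟩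
  · intro x
    obtain ⟨n', hn'⟩ := (hΩ x).1 x.2
    obtain ⟨n, hn⟩ := hΩ' x x.2
    refine ⟨Submodule.Quotient.mk (-n, n', (x : P)), ?_⟩
    rw [hg, hG, ht, hn', map_neg, hn]
    simp

/-- Frames with prescribed cokernel, images and kernel up to isomorphism. -/
theorem card_frame_of_shape [Finite M] [Finite N] [Finite M'] [Finite N']
    (X₁ X₂ X₃ X₄ : Type*) [AddCommGroup X₁] [AddCommGroup X₂] [AddCommGroup X₃] [AddCommGroup X₄]
    [Module R X₁] [Module R X₂] [Module R X₃] [Module R X₄] :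
    Nat.card {f : Frame R M N M' N' // Nonempty ((M ⧸ LinearMap.range f.1) ≃ₗ[R] X₁) ∧
        Nonempty (LinearMap.range f.1 ≃ₗ[R] X₂) ∧ Nonempty (LinearMap.range f.2.1 ≃ₗ[R] X₃) ∧
        Nonempty (LinearMap.ker f.2.1 ≃ₗ[R] X₄)} =
      (Nat.card {V : Submodule R M // Nonempty ((M ⧸ V) ≃ₗ[R] X₁) ∧ Nonempty (V ≃ₗ[R] X₂)} *
        Nat.card {U : Submodule R N' // Nonempty ((N' ⧸ U) ≃ₗ[R] X₂) ∧ Nonempty (U ≃ₗ[R] X₄)} *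
        Nat.card (X₂ ≃ₗ[R] X₂)) *
      (Nat.card {V : Submodule R M' // Nonempty ((M' ⧸ V) ≃ₗ[R] X₁) ∧ Nonempty (V ≃ₗ[R] X₃)} *
        Nat.card {U : Submodule R N // Nonempty ((N ⧸ U) ≃ₗ[R] X₃) ∧ Nonempty (U ≃ₗ[R] X₄)} *
        Nat.card (X₃ ≃ₗ[R] X₃)) *
      (Nat.card (X₁ ≃ₗ[R] X₁) * Nat.card (X₄ ≃ₗ[R] X₄)) := by
  rw [← card_linearMap_of_shape (fun V : Submodule R M => Nonempty ((M ⧸ V) ≃ₗ[R] X₁))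
      (fun U : Submodule R N' => Nonempty (U ≃ₗ[R] X₄)) X₂,
    ← card_linearMap_of_shape (fun V : Submodule R M' => Nonempty ((M' ⧸ V) ≃ₗ[R] X₁))
      (fun U : Submodule R N => Nonempty (U ≃ₗ[R] X₄)) X₃, ← Nat.card_prod,
    ← card_sigma_eq_mul (β := fun x => ((M ⧸ LinearMap.range x.1.1) ≃ₗ[R]
      (M' ⧸ LinearMap.range x.2.1)) × (LinearMap.ker x.2.1 ≃ₗ[R] LinearMap.ker x.1.1))]
  · refine Nat.card_congr
      { toFun := fun f => ⟨⟨⟨f.1.1, f.2.1, ⟨f.1.2.2.2.symm.trans f.2.2.2.2.some⟩, f.2.2.1⟩,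
          ⟨f.1.2.1, ⟨f.1.2.2.1.symm.trans f.2.1.some⟩, f.2.2.2.2, f.2.2.2.1⟩⟩, f.1.2.2⟩
        invFun := fun x => ⟨⟨x.1.1.1, x.1.2.1, x.2⟩, x.1.1.2.1, x.1.1.2.2.2, x.1.2.2.2.2,
          x.1.2.2.2.1⟩
        left_inv := fun _ => rfl
        right_inv := fun _ => rfl }
  · intro x
    rw [Nat.card_prod, card_linearEquiv_congr x.1.2.1.some x.2.2.1.some,
      card_linearEquiv_congr x.2.2.2.1.some x.1.2.2.1.some]

end Counting

section Classes

/-- The isomorphism class of a finite module. -/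
def cls (X : Type) [AddCommGroup X] [Module Λᵐᵒᵖ X] [Finite X] : IsoCls Λ :=
  Quotient.mk isoSetoid ⟨X⟩

theorem cls_eq_iff (X : Type) [AddCommGroup X] [Module Λᵐᵒᵖ X] [Finite X] (x : IsoCls Λ) :
    cls X = x ↔ Nonempty (X ≃ₗ[Λᵐᵒᵖ] x.out.carrier) :=
  Quotient.mk_eq_iff_out

open Classical in
theorem card_linearEquiv_out (X : Type) [AddCommGroup X] [Module Λᵐᵒᵖ X] [Finite X]
    (x : IsoCls Λ) :
    Nat.card (X ≃ₗ[Λᵐᵒᵖ] x.out.carrier) = if cls X = x then aut x.out else 0 := by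
  split_ifs with h
  · obtain ⟨e⟩ := (cls_eq_iff X x).1 h
    exact card_linearEquiv_congr e (.refl _ _)
  · rw [cls_eq_iff, not_nonempty_iff] at h
    exact Nat.card_of_isEmpty

open Classical in
theorem finsum_sum_ite {ι κ : Type*} [Fintype ι] (g : ι → κ) (k : ι → κ → ℚ) :
    ∑ᶠ x, ∑ i, (if g i = x then k i x else 0) = ∑ i, k i (g i) := by
  rw [finsum_sum_comm]
  · refine Finset.sum_congr rfl fun i _ => ?_
    rw [finsum_eq_single _ (g i) fun x hx => if_neg hx.symm, if_pos rfl]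
  · intro i _
    refine (Set.finite_singleton (g i)).subset fun x hx => ?_
    by_contra h
    exact hx (if_neg fun h' => h h'.symm)

open Classical in
theorem finsum_mul_card_fiber {ι κ : Type*} [Fintype ι] (g : ι → κ) (w : κ → ℚ) :
    ∑ᶠ x, w x * Nat.card {i // g i = x} = ∑ i, w (g i) := by
  rw [← finsum_sum_ite g fun _ => w]
  refine finsum_congr fun x => ?_
  rw [← Finset.sum_filter, Finset.sum_const, nsmul_eq_mul, mul_comm, Nat.card_eq_fintype_card,
    Fintype.card_subtype]

variable (M N M' N' : FinMod Λ)

theorem hallNum_mul_hallNum_div (x : IsoCls Λ) [Finite M.carrier] [Finite N.carrier]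
    [Finite M'.carrier] [Finite N'.carrier] [Finite x.out.carrier]
    [Fintype (Frame Λᵐᵒᵖ M.carrier N.carrier M'.carrier N'.carrier)]
    {P : Type} [AddCommGroup P] [Module Λᵐᵒᵖ P] [Finite P] [Module.Projective Λᵐᵒᵖ P]
    (τ₁ : P →ₗ[Λᵐᵒᵖ] M.carrier) (hτ₁ : Function.Surjective τ₁)
    (τ₂ : Frame Λᵐᵒᵖ M.carrier N.carrier M'.carrier N'.carrier → P →ₗ[Λᵐᵒᵖ] M'.carrier)
    (hτ : ∀ f : Frame Λᵐᵒᵖ M.carrier N.carrier M'.carrier N'.carrier, ∀ x,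
      f.2.2.1 (Submodule.Quotient.mk (τ₁ x)) = Submodule.Quotient.mk (τ₂ f x))
    [∀ f, Fintype {U // IsKernel f τ₁ (τ₂ f) U}] [DecidableEq (IsoCls Λ)] :
    (aut M * aut N * aut M' * aut N' : ℚ) *
        ((hallNum x.out M N * hallNum x.out M' N' : ℚ) / (aut x.out : ℚ)) =
      ∑ i : Σ f, {U // IsKernel f τ₁ (τ₂ f) U}, if cls (_ ⧸ i.2.1) = x then
        (Nat.card (P →ₗ[Λᵐᵒᵖ] LinearMap.ker i.1.2.1) : ℚ)⁻¹ else 0 := by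
  have haut : (aut x.out : ℚ) ≠ 0 := by
    have : 0 < aut x.out := Nat.card_pos
    exact_mod_cast this.ne'
  have hpos (f : Frame Λᵐᵒᵖ M.carrier N.carrier M'.carrier N'.carrier) :
      (Nat.card (P →ₗ[Λᵐᵒᵖ] LinearMap.ker f.2.1) : ℚ) ≠ 0 := by
    have : 0 < Nat.card (P →ₗ[Λᵐᵒᵖ] LinearMap.ker f.2.1) := Nat.card_pos
    exact_mod_cast this.ne'
  have h := card_SES_mul_card_SES (R := Λᵐᵒᵖ) (M := M.carrier) (N := N.carrier)
    (M' := M'.carrier) (N' := N'.carrier) (L := x.out.carrier)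
  rw [card_SES, card_SES] at h
  have h1 : (aut M * aut N * aut M' * aut N' : ℚ) * (hallNum x.out M N * hallNum x.out M' N') =
      ∑ f, (Nat.card {c : SES Λᵐᵒᵖ M.carrier N.carrier x.out.carrier ×
        SES Λᵐᵒᵖ M'.carrier N'.carrier x.out.carrier // Fits c f} : ℚ) := by
    rw [← Nat.cast_sum, ← h]
    push_cast
    simp only [aut, hallNum]
    ring
  rw [← mul_div_assoc, h1, Finset.sum_div]
  trans ∑ f, ∑ U : {U // IsKernel f τ₁ (τ₂ f) U}, if cls (_ ⧸ U.1) = x then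
        (Nat.card (P →ₗ[Λᵐᵒᵖ] LinearMap.ker f.2.1) : ℚ)⁻¹ else 0
  · refine Finset.sum_congr rfl fun f _ => ?_
    have h2 := card_fits_mul (L := x.out.carrier) f τ₁ (τ₂ f) hτ₁ (hτ f)
    rw [Nat.card_sigma] at h2
    simp only [card_linearEquiv_out] at h2
    have h3 := congrArg (Nat.cast (R := ℚ)) h2
    push_cast at h3
    rw [eq_div_of_mul_eq (hpos f) h3, Finset.sum_div, Finset.sum_div]
    refine Finset.sum_congr rfl fun U _ => ?_
    by_cases hU : cls (_ ⧸ U.1) = x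
    · simp only [if_pos hU]
      field_simp
    · simp only [if_neg hU, zero_div]
  · rw [Fintype.sum_sigma]

end Classes

/-- Green's formula for finite-dimensional hereditary `𝔽_q`-algebras. -/
theorem green_formula (q : ℕ) (hq : IsPrimePow q)
    (F : Type) [Field F] [Fintype F] (hF : Fintype.card F = q)
    [Algebra F Λ] [FiniteDimensional F Λ]
    -- `Λ` is hereditary: every submodule of a projective finitely generated
    -- right `Λ`-module is projective
    (hhered : ∀ (M : Type) [AddCommGroup M] [Module Λᵐᵒᵖ M] [Module.Finite Λᵐᵒᵖ M],
      Module.Projective Λᵐᵒᵖ M → ∀ N : Submodule Λᵐᵒᵖ M, Module.Projective Λᵐᵒᵖ N)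
    (M N M' N' : FinMod Λ) :
    (aut M * aut N * aut M' * aut N' : ℚ) *
        ∑ᶠ l : IsoCls Λ,
          (hallNum l.out M N * hallNum l.out M' N' : ℚ) / (aut l.out : ℚ)
      = ∑ᶠ x : IsoCls Λ × IsoCls Λ × IsoCls Λ × IsoCls Λ,
          (q : ℚ) ^ (-(euler q x.1.out x.2.2.2.out)) *
            (hallNum M x.1.out x.2.1.out : ℚ) *
            (hallNum N x.2.2.1.out x.2.2.2.out : ℚ) *
            (hallNum M' x.1.out x.2.2.1.out : ℚ) *
            (hallNum N' x.2.1.out x.2.2.2.out : ℚ) *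
            (aut x.1.out : ℚ) * (aut x.2.1.out : ℚ) *
            (aut x.2.2.1.out : ℚ) * (aut x.2.2.2.out : ℚ) := by
  classical
  have hqF : q = Nat.card F := by rw [Nat.card_eq_fintype_card, hF]
  have : Finite Λ := Module.finite_of_finite F
  have : Finite Λᵐᵒᵖ := Finite.of_equiv _ MulOpposite.opEquiv
  have hfin (X : FinMod Λ) : Finite X.carrier := Module.finite_of_finite Λᵐᵒᵖ
  have := Fintype.ofFinite (Frame Λᵐᵒᵖ M.carrier N.carrier M'.carrier N'.carrier)
  obtain ⟨n, τ₁, hτ₁⟩ := Module.Finite.exists_fin' Λᵐᵒᵖ M.carrier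
  have hτ₂ (f : Frame Λᵐᵒᵖ M.carrier N.carrier M'.carrier N'.carrier) :
      ∃ τ₂ : (Fin n → Λᵐᵒᵖ) →ₗ[Λᵐᵒᵖ] M'.carrier, ∀ x,
        f.2.2.1 (Submodule.Quotient.mk (τ₁ x)) = Submodule.Quotient.mk (τ₂ x) := by
    obtain ⟨τ₂, h⟩ := Module.projective_lifting_property (LinearMap.range f.2.1).mkQ
      (f.2.2.1.toLinearMap ∘ₗ (LinearMap.range f.1).mkQ ∘ₗ τ₁) (Submodule.mkQ_surjective _)
    exact ⟨τ₂, fun x => (LinearMap.congr_fun h x).symm⟩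
  choose τ₂ hτ using hτ₂
  have (f : Frame Λᵐᵒᵖ M.carrier N.carrier M'.carrier N'.carrier) :
      Fintype {U // IsKernel f τ₁ (τ₂ f) U} := Fintype.ofFinite _
  let shape (f : Frame Λᵐᵒᵖ M.carrier N.carrier M'.carrier N'.carrier) :
      IsoCls Λ × IsoCls Λ × IsoCls Λ × IsoCls Λ :=
    (cls (_ ⧸ LinearMap.range f.1), cls (LinearMap.range f.1), cls (LinearMap.range f.2.1),
      cls (LinearMap.ker f.2.1))
  trans ∑ f, (q : ℚ) ^ (-(euler q (shape f).1.out (shape f).2.2.2.out))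
  · rw [← smul_eq_mul, smul_finsum]
    simp only [smul_eq_mul]
    simp only [hallNum_mul_hallNum_div M N M' N' _ τ₁ hτ₁ τ₂ hτ]
    rw [finsum_sum_ite, ← Finset.univ_sigma_univ, Finset.sum_sigma]
    refine Finset.sum_congr rfl fun f _ => ?_
    obtain ⟨e⟩ := (cls_eq_iff (_ ⧸ LinearMap.range f.1) (shape f).1).1 rfl
    obtain ⟨e'⟩ := (cls_eq_iff (LinearMap.ker f.2.1) (shape f).2.2.2).1 rfl
    have h0 : LinearMap.ker ((LinearMap.range f.1).mkQ ∘ₗ τ₁) =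
        LinearMap.ker (e.toLinearMap ∘ₗ (LinearMap.range f.1).mkQ ∘ₗ τ₁) := by
      rw [LinearEquiv.ker_comp]
    have := hhered (Fin n → Λᵐᵒᵖ) inferInstance (LinearMap.ker ((LinearMap.range f.1).mkQ ∘ₗ τ₁))
    have h1 := pow_neg_euler F (shape f).1.out (shape f).2.2.2.out
      (e.toLinearMap ∘ₗ (LinearMap.range f.1).mkQ ∘ₗ τ₁)
      (e.surjective.comp ((Submodule.mkQ_surjective _).comp hτ₁))
    rw [← card_linearMap_congr (.refl _ _) e', ← card_linearMap_congr (LinearEquiv.ofEq _ _ h0) e',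
      ← card_isKernel f τ₁ (τ₂ f) (hτ f), ← hqF] at h1
    have hpos : (Nat.card ((Fin n → Λᵐᵒᵖ) →ₗ[Λᵐᵒᵖ] LinearMap.ker f.2.1) : ℚ) ≠ 0 := by
      exact_mod_cast Nat.card_pos.ne'
    refine (Finset.sum_const (Nat.card ((Fin n → Λᵐᵒᵖ) →ₗ[Λᵐᵒᵖ] LinearMap.ker f.2.1) : ℚ)⁻¹).trans ?_
    rw [nsmul_eq_mul, eq_div_of_mul_eq hpos h1, Finset.card_univ,
      ← Nat.card_eq_fintype_card, div_eq_mul_inv]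
  · rw [← finsum_mul_card_fiber shape
      fun x => (q : ℚ) ^ (-(euler q x.1.out x.2.2.2.out))]
    refine finsum_congr fun x => ?_
    have h := card_frame_of_shape (R := Λᵐᵒᵖ) (M := M.carrier) (N := N.carrier)
      (M' := M'.carrier) (N' := N'.carrier) x.1.out.carrier x.2.1.out.carrier
      x.2.2.1.out.carrier x.2.2.2.out.carrier
    have h1 : Nat.card {f // shape f = x} = _ := (Nat.card_congr (Equiv.subtypeEquivRight
      fun f => by simp only [shape, Prod.ext_iff, cls_eq_iff])).trans h
    rw [h1]
    simp only [hallNum, aut]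
    push_cast
    ring

end GreenModules
end

section
/- Green's formula in a finitary hereditary category: for all objects M, N, M', N' of 𝒜, one has a_M · a_N · a_{M'} · a_{N'} · Σ_{[L]} g^L_{MN} · g^L_{M'N'} · a_L^{-1} = Σ_{[M₁],[M₂],[N₁],[N₂]} q^{-⟨M₁,N₂⟩} · g^M_{M₁M₂} · g^N_{N₁N₂} · g^{M'}_{M₁N₁} · g^{N'}_{M₂N₂} · a_{M₁} · a_{M₂} · a_{N₁} · a_{N₂}, where the sums range over isomorphism classes of objects of 𝒜 and have only finitely many nonzero terms, and the identity is an equality of rational numbers. -/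
/-!
Green's formula in an essentially small, 𝔽_q-linear, hereditary, finitary abelian
category `𝒜` in which every object has finitely many subobjects:
for all objects `M N M' N'`,
  a_M a_N a_{M'} a_{N'} ∑_{[L]} g^L_{MN} g^L_{M'N'} / a_L
    = ∑_{[M₁],[M₂],[N₁],[N₂]} q^{-⟨M₁,N₂⟩} g^M_{M₁M₂} g^N_{N₁N₂} g^{M'}_{M₁N₁}
        g^{N'}_{M₂N₂} a_{M₁} a_{M₂} a_{N₁} a_{N₂},
as an identity of rational numbers, the sums ranging over isomorphism classes.
-/

open CategoryTheory CategoryTheory.Limits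

universe v u

namespace GreenFormulaCat

variable (C : Type u) [Category.{v} C] [Abelian C]

/-- Ext groups exist (with the standard construction of the derived category). -/
instance hasExtStandard : HasExt.{max u v} C :=
  letI := HasDerivedCategory.standard C
  hasExt_of_hasDerivedCategory C

/-- Objects are equivalent iff they are isomorphic. -/
def isoSetoid : Setoid C where
  r X Y := Nonempty (X ≅ Y)
  iseqv := ⟨fun X => ⟨Iso.refl X⟩, fun ⟨e⟩ => ⟨e.symm⟩, fun ⟨e⟩ ⟨f⟩ => ⟨e.trans f⟩⟩

/-- The type of isomorphism classes of objects of `C`. -/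
def IsoCls : Type u := Quotient (isoSetoid C)

variable {C}

/-- `a_X = |Aut X|`, the number of automorphisms of `X`. -/
noncomputable def aut (X : C) : ℕ := Nat.card (Aut X)

/-- The Hall number `g^L_{MN}`: the number of subobjects `L'` of `L` with
`L' ≅ N` and `L/L' ≅ M`. -/
noncomputable def hallNum (L M N : C) : ℕ :=
  Nat.card {L' : Subobject L //
    Nonempty ((L' : C) ≅ N) ∧ Nonempty (cokernel L'.arrow ≅ M)}

/-- The Euler form `⟨M,N⟩ = dim_{𝔽_q} Hom(M,N) - dim_{𝔽_q} Ext¹(M,N)`, the dimension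
of a finite `𝔽_q`-vector space `W` being computed as `log_q |W|`. -/
noncomputable def euler (q : ℕ) (M N : C) : ℤ :=
  (Nat.log q (Nat.card (M ⟶ N)) : ℤ) -
    (Nat.log q (Nat.card (Abelian.Ext.{max u v} M N 1)) : ℤ)

open Pretriangulated DerivedCategory in
/-- A distinguished triangle on objects of `C` placed in degree zero comes from a short exact
sequence, whose class is the third morphism. -/
theorem shortExact_of_distTriang [HasDerivedCategory C] (S : ShortComplex C)
    (δ : (singleFunctor C 0).obj S.X₃ ⟶ ((singleFunctor C 0).obj S.X₁)⟦(1 : ℤ)⟧)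
    (hT : Triangle.mk ((singleFunctor C 0).map S.f) ((singleFunctor C 0).map S.g) δ ∈
      distTriang (DerivedCategory C)) :
    ∃ hS : S.ShortExact, hS.singleδ = δ := by
  set T := Triangle.mk ((singleFunctor C 0).map S.f) ((singleFunctor C 0).map S.g) δ with hTdef
  have e := singleFunctorCompHomologyFunctorIso C 0
  have hm : Mono ((homologyFunctor C 0).map T.mor₁) := by
    rw [HomologySequence.mono_homologyMap_mor₁_iff T hT (-1) 0]
    exact (isZero_of_isGE ((singleFunctor C 0).obj S.X₃) 0 (-1) (by lia)).eq_of_src _ _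
  have he : Epi ((homologyFunctor C 0).map T.mor₂) := by
    rw [HomologySequence.epi_homologyMap_mor₂_iff T hT 0 1]
    exact (isZero_of_isLE ((singleFunctor C 0).obj S.X₁) 0 1 (by lia)).eq_of_tgt _ _
  have hx := HomologySequence.exact₂ T hT 0
  have hS : S.ShortExact :=
    { exact := ShortComplex.exact_of_iso
        (ShortComplex.isoMk (e.app _) (e.app _) (e.app _)
          (e.hom.naturality S.f).symm (e.hom.naturality S.g).symm) hx
      mono_f := ((MorphismProperty.monomorphisms C).arrow_mk_iso_iff
        (Arrow.isoMk (e.app _) (e.app _) (e.hom.naturality S.f).symm)).1 hm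
      epi_g := ((MorphismProperty.epimorphisms C).arrow_mk_iso_iff
        (Arrow.isoMk (e.app _) (e.app _) (e.hom.naturality S.g).symm)).1 he }
  refine ⟨hS, ?_⟩
  obtain ⟨c, hc₁, hc₂⟩ := complete_distinguished_triangle_morphism _ _
    hS.singleTriangle_distinguished hT (𝟙 _) (𝟙 _)
    ((Category.comp_id _).trans (Category.id_comp _).symm)
  obtain ⟨c', rfl⟩ := (singleFunctor C 0).map_surjective c
  replace hc₁ : (singleFunctor C 0).map S.g ≫ (singleFunctor C 0).map c' =
    𝟙 ((singleFunctor C 0).obj S.X₂) ≫ (singleFunctor C 0).map S.g := hc₁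
  replace hc₂ : hS.singleδ ≫ (𝟙 ((singleFunctor C 0).obj S.X₁))⟦(1 : ℤ)⟧' =
    (singleFunctor C 0).map c' ≫ δ := hc₂
  have hc' : c' = 𝟙 _ := by
    have := hS.epi_g
    rw [← cancel_epi S.g]
    apply (singleFunctor C 0).map_injective
    simpa using hc₁
  subst hc'
  simpa using hc₂

open Pretriangulated DerivedCategory in
theorem exists_extClass_eq (Y X : C) (ε : Abelian.Ext.{max u v} X Y 1) :
    ∃ (L : C) (n : Y ⟶ L) (π : L ⟶ X) (w : n ≫ π = 0) (h : (ShortComplex.mk n π w).ShortExact),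
      h.extClass = ε := by
  let := HasDerivedCategory.standard C
  obtain ⟨Z, f, g, hT⟩ := distinguished_cocone_triangle₂ ε.hom
  have : Z.IsLE 0 := TStructure.t.isLE₂ _ hT 0
    (inferInstanceAs (((singleFunctor C 0).obj Y).IsLE 0))
    (inferInstanceAs (((singleFunctor C 0).obj X).IsLE 0))
  have : Z.IsGE 0 := TStructure.t.isGE₂ _ hT 0
    (inferInstanceAs (((singleFunctor C 0).obj Y).IsGE 0))
    (inferInstanceAs (((singleFunctor C 0).obj X).IsGE 0))
  obtain ⟨L, ⟨e⟩⟩ := exists_iso_singleFunctor_obj_of_isGE_of_isLE Z 0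
  obtain ⟨n, hn⟩ := (singleFunctor C 0).map_surjective (f ≫ e.hom)
  obtain ⟨π, hπ⟩ := (singleFunctor C 0).map_surjective (e.inv ≫ g)
  have w : n ≫ π = 0 := by
    apply (singleFunctor C 0).map_injective
    have : f ≫ g = 0 := comp_distTriang_mor_zero₁₂ _ hT
    simpa [hn, hπ] using this
  have e' : Triangle.mk ((singleFunctor C 0).map n) ((singleFunctor C 0).map π) ε.hom ≅
      Triangle.mk f g ε.hom := by
    refine Triangle.isoMk _ _ (Iso.refl _) e.symm (Iso.refl _) ?_ ?_ ?_
    · change (singleFunctor C 0).map n ≫ e.inv = 𝟙 ((singleFunctor C 0).obj Y) ≫ f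
      simp [hn]
    · change (singleFunctor C 0).map π ≫ 𝟙 ((singleFunctor C 0).obj X) = e.inv ≫ g
      simp [hπ]
    · change ε.hom ≫ (𝟙 ((singleFunctor C 0).obj Y))⟦(1 : ℤ)⟧' =
        𝟙 ((singleFunctor C 0).obj X) ≫ ε.hom
      simp
  obtain ⟨hS, h⟩ := shortExact_of_distTriang (ShortComplex.mk n π w) ε.hom
    (isomorphic_distinguished _ hT _ e')
  refine ⟨L, n, π, w, hS, ?_⟩
  ext
  rw [ShortComplex.ShortExact.extClass_hom, h]

section Counting

theorem card_eq_card_range_mul_card_range {A B D : Type*} [AddCommGroup A] [AddCommGroup B]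
    [AddCommGroup D] (f : A →+ B) (g : B →+ D) (h : Function.Exact f g) :
    Nat.card B = Nat.card f.range * Nat.card g.range := by
  have hk : g.ker = f.range := by
    ext x
    exact h x
  rw [← hk, AddSubgroup.card_eq_card_quotient_mul_card_addSubgroup g.ker, mul_comm,
    Nat.card_congr (QuotientAddGroup.quotientKerEquivRange g).toEquiv]

theorem card_fiber_eq_card_ker {A B : Type*} [AddCommGroup A] [AddCommGroup B] (f : A →+ B)
    (a : A) : Nat.card {x : A // f x = f a} = Nat.card f.ker :=
  Nat.card_congr
    { toFun := fun x => ⟨x.1 - a, by simp [AddMonoidHom.mem_ker, x.2]⟩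
      invFun := fun x => ⟨x.1 + a, by simp [AddMonoidHom.mem_ker.1 x.2]⟩
      left_inv := fun x => by simp
      right_inv := fun x => by simp }

theorem card_sigma_const {α : Type*} {β : α → Type*} (k : ℕ) [Finite α]
    [∀ a, Finite (β a)] (h : ∀ a, Nat.card (β a) = k) :
    Nat.card (Σ a, β a) = Nat.card α * k := by
  have := Fintype.ofFinite α
  rw [Nat.card_sigma, Finset.sum_congr rfl fun a _ => h a]
  simp

end Counting

/-- The pair `(i, p)` is a short exact sequence `0 ⟶ N ⟶ L ⟶ M ⟶ 0`. -/
def IsSES {N L M : C} (i : N ⟶ L) (p : L ⟶ M) : Prop :=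
  ∃ w : i ≫ p = 0, (ShortComplex.mk i p w).ShortExact

namespace IsSES

variable {N L M : C} {i : N ⟶ L} {p : L ⟶ M} (h : IsSES i p)

include h

theorem zero : i ≫ p = 0 := h.1

theorem shortExact : (ShortComplex.mk i p h.zero).ShortExact := h.2

theorem mono : Mono i := h.shortExact.mono_f

theorem epi : Epi p := h.shortExact.epi_g

theorem exists_lift {T : C} (t : T ⟶ L) (ht : t ≫ p = 0) : ∃ s : T ⟶ N, s ≫ i = t := by
  have := h.mono
  exact ⟨h.shortExact.exact.lift t ht, h.shortExact.exact.lift_f t ht⟩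

theorem exists_desc {T : C} (t : L ⟶ T) (ht : i ≫ t = 0) : ∃ s : M ⟶ T, p ≫ s = t := by
  have := h.epi
  exact ⟨h.shortExact.exact.desc t ht, h.shortExact.exact.g_desc t ht⟩

/-- The class in `Ext¹` of a short exact sequence. -/
noncomputable def cls : Abelian.Ext.{max u v} M N 1 := h.shortExact.extClass

end IsSES

/-- The type of short exact sequences `0 ⟶ N ⟶ L ⟶ M ⟶ 0` with fixed objects. -/
def SES (N L M : C) : Type v := {x : (N ⟶ L) × (L ⟶ M) // IsSES x.1 x.2}

open Abelian

section MapsOfExtensions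

variable {Y L X N A : C} {n : Y ⟶ L} {π : L ⟶ X} (hS : IsSES n π) {c : Y ⟶ N} {d : N ⟶ A}
  (hT : IsSES c d) (u : A ⟶ X)

/-- Morphisms of extensions which are the identity on the left and `u` on the right. -/
def ExtMap (n : Y ⟶ L) (π : L ⟶ X) (c : Y ⟶ N) (d : N ⟶ A) (u : A ⟶ X) : Type v :=
  {i : N ⟶ L // c ≫ i = n ∧ i ≫ π = d ≫ u}

include hS hT

theorem nonempty_extMap_iff :
    Nonempty (ExtMap n π c d u) ↔ (Ext.mk₀ u).comp hS.cls (zero_add 1) = hT.cls := by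
  constructor
  · rintro ⟨i, h₁, h₂⟩
    have := ShortComplex.ShortExact.extClass_naturality hT.shortExact hS.shortExact
      { τ₁ := 𝟙 Y, τ₂ := i, τ₃ := u, comm₁₂ := by simp [h₁], comm₂₃ := by simp [h₂] }
    simpa [IsSES.cls] using this.symm
  · intro h
    obtain ⟨x, hx⟩ := Ext.covariant_sequence_exact₃ N hS.shortExact (Ext.mk₀ (d ≫ u)) (zero_add 1)
      (by
        have h₀ := ShortComplex.ShortExact.comp_extClass hT.shortExact
        dsimp at h₀ ⊢
        rw [← Ext.mk₀_comp_mk₀_assoc]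
        exact (congrArg (fun e => (Ext.mk₀ d).comp e (zero_add 1)) h).trans h₀)
    obtain ⟨i₀, rfl⟩ := Ext.addEquiv₀.symm.surjective x
    have hi₀ : i₀ ≫ π = d ≫ u := by
      apply (Ext.mk₀_bijective _ _).1
      rw [← Ext.mk₀_comp_mk₀]
      exact hx
    obtain ⟨v, hv⟩ := hS.exists_lift (c ≫ i₀) (by rw [Category.assoc, hi₀, ← Category.assoc,
      hT.zero, zero_comp])
    have nat := ShortComplex.ShortExact.extClass_naturality hT.shortExact hS.shortExact
      { τ₁ := v, τ₂ := i₀, τ₃ := u, comm₁₂ := by simp [hv], comm₂₃ := by simp [hi₀] }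
    have h₁ : hT.cls.comp (Ext.mk₀ v) (add_zero 1) = hT.cls :=
      nat.trans h
    obtain ⟨y, hy⟩ := Ext.contravariant_sequence_exact₁ hT.shortExact Y (Ext.mk₀ (v - 𝟙 Y))
      (add_zero 1) (by
        rw [sub_eq_add_neg, Ext.mk₀_add, Ext.mk₀_neg, Ext.comp_add, Ext.comp_neg, Ext.comp_mk₀_id]
        exact sub_eq_zero.2 h₁ |> (sub_eq_add_neg _ _).symm.trans)
    obtain ⟨w, rfl⟩ := Ext.addEquiv₀.symm.surjective y
    have hw : c ≫ w = v - 𝟙 Y := by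
      apply (Ext.mk₀_bijective _ _).1
      rw [← Ext.mk₀_comp_mk₀]
      exact hy
    refine ⟨i₀ - w ≫ n, ?_, ?_⟩
    · rw [Preadditive.comp_sub, ← Category.assoc, hw, Preadditive.sub_comp, hv]
      simp
    · rw [Preadditive.sub_comp, Category.assoc, hS.zero, hi₀]
      simp

theorem card_extMap (h : (Ext.mk₀ u).comp hS.cls (zero_add 1) = hT.cls) :
    Nat.card (ExtMap n π c d u) = Nat.card (A ⟶ Y) := by
  obtain ⟨i₀, h₁, h₂⟩ := (nonempty_extMap_iff hS hT u).2 h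
  symm
  refine Nat.card_congr (Equiv.ofBijective (fun w => ⟨i₀ + d ≫ w ≫ n, ?_, ?_⟩) ⟨?_, ?_⟩)
  · rw [Preadditive.comp_add, h₁, ← Category.assoc, hT.zero, zero_comp, add_zero]
  · simp [h₂, hS.zero]
  · intro w w' hw
    have := hS.mono
    have := hT.epi
    simpa [cancel_epi, cancel_mono] using congrArg Subtype.val hw
  · rintro ⟨i, h₃, h₄⟩
    obtain ⟨s, hs⟩ := hS.exists_lift (i - i₀) (by simp [h₂, h₄])
    have := hS.mono
    obtain ⟨w, hw⟩ := hT.exists_desc s (by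
      rw [← cancel_mono n, Category.assoc, hs]
      simp [h₁, h₃])
    refine ⟨w, Subtype.ext ?_⟩
    change i₀ + d ≫ w ≫ n = i
    rw [← Category.assoc, hw, hs]
    simp

end MapsOfExtensions

theorem card_ext_zero (X Y : C) : Nat.card (Ext.{max u v} X Y 0) = Nat.card (X ⟶ Y) :=
  Nat.card_congr Ext.addEquiv₀.toEquiv

theorem card_ext_fiber {I P M Y : C} {f : I ⟶ P} {g : P ⟶ M} (h : IsSES f g)
    [Subsingleton (Ext.{max u v} M Y 2)] (η : Ext.{max u v} I Y 1) :
    Nat.card {ε : Ext.{max u v} P Y 1 // (Ext.mk₀ f).comp ε (zero_add 1) = η} *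
        (Nat.card (I ⟶ Y) * Nat.card (M ⟶ Y)) =
      Nat.card (Ext.{max u v} M Y 1) * Nat.card (P ⟶ Y) := by
  have hS := h.shortExact
  have e₁ := (ShortComplex.ab_exact_iff_function_exact _).1
    (Ext.contravariant_sequence_exact₂' hS Y 0)
  have e₂ := (ShortComplex.ab_exact_iff_function_exact _).1
    (Ext.contravariant_sequence_exact₁' hS Y 0 1 rfl)
  have e₃ := (ShortComplex.ab_exact_iff_function_exact _).1
    (Ext.contravariant_sequence_exact₃' hS Y 0 1 rfl)
  have e₄ := (ShortComplex.ab_exact_iff_function_exact _).1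
    (Ext.contravariant_sequence_exact₂' hS Y 1)
  replace e₁ := card_eq_card_range_mul_card_range _ _ e₁
  replace e₂ := card_eq_card_range_mul_card_range _ _ e₂
  replace e₃ := card_eq_card_range_mul_card_range _ _ e₃
  have := h.epi
  have inj := Nat.card_congr
    (AddMonoidHom.ofInjective (Ext.precomp_mk₀_injective_of_epi Y g)).toEquiv
  obtain ⟨ε₀, rfl⟩ := Ext.contravariant_sequence_exact₁ hS Y η (n₁ := 2) rfl
    (Subsingleton.elim _ _)
  have key := card_fiber_eq_card_ker ((Ext.mk₀ f).precomp Y (zero_add 1)) ε₀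
  have hk : ((Ext.mk₀ f).precomp Y (zero_add 1)).ker =
      ((Ext.mk₀ g).precomp Y (zero_add 1)).range := by
    ext x
    exact e₄ x
  rw [hk] at key
  simp only [card_ext_zero] at e₁ e₂ inj
  rw [← card_ext_zero P Y, ← card_ext_zero I Y]
  refine (congrArg (· * _) key).trans ?_
  dsimp at e₁ e₂ e₃ ⊢
  rw [card_ext_zero, card_ext_zero, e₁, e₂, e₃, inj]
  ring

section FiniteSums

/-- The function `f` has finite support and sum `a`. -/
def IsFinsum {ι : Type*} (f : ι → ℚ) (a : ℚ) : Prop :=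
  f.HasFiniteSupport ∧ ∑ᶠ i, f i = a

theorem isFinsum_single {ι : Type*} {f : ι → ℚ} (i : ι) (h : ∀ j, j ≠ i → f j = 0) :
    IsFinsum f (f i) :=
  ⟨(Set.finite_singleton i).subset fun j hj => by
    by_contra hji
    exact hj (h j hji), finsum_eq_single f i h⟩

theorem IsFinsum.const_mul {ι : Type*} {f : ι → ℚ} {a : ℚ} (h : IsFinsum f a) (c : ℚ) :
    IsFinsum (fun i => c * f i) (c * a) :=
  ⟨h.1.subset fun i hi h0 => hi (by simp [show f i = 0 from h0]), by rw [← mul_finsum, h.2]⟩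

theorem IsFinsum.sum {ι α : Type*} [Fintype α] {f : ι → α → ℚ} {a : α → ℚ}
    (h : ∀ x, IsFinsum (fun i => f i x) (a x)) :
    IsFinsum (fun i => ∑ x, f i x) (∑ x, a x) := by
  refine ⟨(Set.finite_iUnion fun x => (h x).1).subset fun i hi => ?_, ?_⟩
  · obtain ⟨x, -, hx⟩ := Finset.exists_ne_zero_of_sum_ne_zero hi
    exact Set.mem_iUnion.2 ⟨x, hx⟩
  · rw [finsum_sum_comm _ _ fun x _ => (h x).1]
    exact Finset.sum_congr rfl fun x _ => (h x).2

end FiniteSums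

/-- The isomorphism class of an object. -/
def IsoCls.mk (X : C) : IsoCls C := Quotient.mk (isoSetoid C) X

omit [Abelian C] in
theorem nonempty_iso_out_iff {X : C} {l : IsoCls C} :
    Nonempty (X ≅ l.out) ↔ l = IsoCls.mk X := by
  let := isoSetoid C
  constructor
  · rintro ⟨e⟩
    exact (Quotient.out_eq l).symm.trans (Quotient.sound ⟨e.symm⟩)
  · intro h
    obtain ⟨e⟩ : Nonempty (l.out ≅ X) := Quotient.exact ((Quotient.out_eq l).trans h)
    exact ⟨e.symm⟩

omit [Abelian C] in
theorem card_iso_eq_aut {X Y : C} (e : X ≅ Y) : Nat.card (X ≅ Y) = aut Y :=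
  Nat.card_congr
    { toFun := fun f => e.symm ≪≫ f
      invFun := fun f => e ≪≫ f
      left_inv := fun f => by ext; simp
      right_inv := fun f => Iso.ext (e.inv_hom_id_assoc f.hom) }

omit [Abelian C] in
instance finite_iso {X Y : C} [Finite (X ⟶ Y)] : Finite (X ≅ Y) :=
  Finite.of_injective Iso.hom fun _ _ h => Iso.ext h

omit [Abelian C] in
theorem aut_pos (X : C) [Finite (X ⟶ X)] : 0 < aut X :=
  have : Finite (Aut X) := finite_iso
  Nat.card_pos

theorem IsSES.comp_iso {Y L X L' : C} {n : Y ⟶ L} {π : L ⟶ X} (h : IsSES n π) (e : L ≅ L') :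
    IsSES (n ≫ e.hom) (e.inv ≫ π) :=
  ⟨by simp [h.zero], ShortComplex.shortExact_of_iso
    (ShortComplex.isoMk (S₁ := ShortComplex.mk n π h.zero) (Iso.refl _) e (Iso.refl _)
      (by simp) (by simp)) h.shortExact⟩

section Riedtmann

variable {Y X L₀ : C} {n₀ : Y ⟶ L₀} {π₀ : L₀ ⟶ X} (h₀ : IsSES n₀ π₀)

/-- An isomorphism out of the middle term of an extension amounts to an equivalent extension
together with an equivalence of extensions. -/
noncomputable def isoEquiv (L : C) :
    (L₀ ≅ L) ≃ Σ s : {s : SES Y L X // s.2.cls = h₀.cls}, ExtMap s.1.1.1 s.1.1.2 n₀ π₀ (𝟙 X) where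
  toFun e := ⟨⟨⟨(n₀ ≫ e.hom, e.inv ≫ π₀), h₀.comp_iso e⟩, by
    have := (nonempty_extMap_iff (h₀.comp_iso e) h₀ (𝟙 X)).1 ⟨⟨e.hom, by simp, by simp⟩⟩
    rwa [Ext.mk₀_id_comp] at this⟩, ⟨e.hom, by simp, by simp⟩⟩
  invFun x :=
    have : IsIso x.2.1 := ShortComplex.isIso₂_of_shortExact_of_isIso₁₃
      (S₁ := ShortComplex.mk n₀ π₀ h₀.zero) (S₂ := ShortComplex.mk _ _ x.1.1.2.zero)
      { τ₁ := 𝟙 Y, τ₂ := x.2.1, τ₃ := 𝟙 X, comm₁₂ := by simp [x.2.2.1],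
        comm₂₃ := by simp [x.2.2.2] } h₀.shortExact x.1.1.2.shortExact
    asIso x.2.1
  left_inv e := by ext; rfl
  right_inv := by
    rintro ⟨⟨⟨⟨n, π⟩, h⟩, hc⟩, ⟨i, h₁, h₂⟩⟩
    dsimp only at h₁ h₂ h
    have : IsIso i := ShortComplex.isIso₂_of_shortExact_of_isIso₁₃
      (S₁ := ShortComplex.mk n₀ π₀ h₀.zero) (S₂ := ShortComplex.mk _ _ h.zero)
      { τ₁ := 𝟙 Y, τ₂ := i, τ₃ := 𝟙 X, comm₁₂ := by simp [h₁],
        comm₂₃ := by simp [h₂] } h₀.shortExact h.shortExact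
    subst h₁
    obtain rfl : π = inv i ≫ π₀ := by simpa using h₂
    rfl

end Riedtmann

instance finite_ses {N L M : C} [Finite (N ⟶ L)] [Finite (L ⟶ M)] : Finite (SES N L M) :=
  Subtype.finite

theorem isFinsum_card_ses_cls (hfin : ∀ X Y : C, Finite (X ⟶ Y)) {Y X : C}
    (ε : Ext.{max u v} X Y 1) :
    IsFinsum (fun l : IsoCls C =>
      (Nat.card {s : SES Y l.out X // s.2.cls = ε} : ℚ) / (aut l.out : ℚ))
      (1 / (Nat.card (X ⟶ Y) : ℚ)) := by
  obtain ⟨L₀, n₀, π₀, w, h, hε⟩ := exists_extClass_eq Y X ε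
  have h₀ : IsSES n₀ π₀ := ⟨w, h⟩
  obtain rfl : h₀.cls = ε := hε
  have hcard (L : C) : Nat.card (L₀ ≅ L) =
      Nat.card {s : SES Y L X // s.2.cls = h₀.cls} * Nat.card (X ⟶ Y) := by
    have hk (s : {s : SES Y L X // s.2.cls = h₀.cls}) :
        Nat.card (ExtMap s.1.1.1 s.1.1.2 n₀ π₀ (𝟙 X)) = Nat.card (X ⟶ Y) :=
      card_extMap s.1.2 h₀ _ (by rw [Ext.mk₀_id_comp, s.2])
    have (s : {s : SES Y L X // s.2.cls = h₀.cls}) :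
        Finite (ExtMap s.1.1.1 s.1.1.2 n₀ π₀ (𝟙 X)) := Subtype.finite
    rw [Nat.card_congr (isoEquiv h₀ L), card_sigma_const _ hk]
  have hXY : (Nat.card (X ⟶ Y) : ℚ) ≠ 0 := by exact_mod_cast Nat.card_pos.ne'
  convert isFinsum_single (IsoCls.mk L₀) (f := fun l : IsoCls C =>
      (Nat.card {s : SES Y l.out X // s.2.cls = h₀.cls} : ℚ) / (aut l.out : ℚ)) ?_ using 1
  · obtain ⟨e⟩ := nonempty_iso_out_iff.2 (Eq.refl (IsoCls.mk L₀))
    have ha := aut_pos (IsoCls.mk L₀).out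
    rw [div_eq_div_iff hXY (by exact_mod_cast ha.ne'), one_mul, ← card_iso_eq_aut e]
    exact_mod_cast hcard _
  · intro l hl
    have : IsEmpty (L₀ ≅ l.out) := not_nonempty_iff.1 fun h => hl (nonempty_iso_out_iff.1 h)
    have h' := hcard l.out
    rw [Nat.card_of_isEmpty] at h'
    rcases Nat.mul_eq_zero.1 h'.symm with h' | h'
    · simp [h']
    · exact absurd (by exact_mod_cast h') hXY

theorem isFinsum_card_ses (hfin : ∀ X Y : C, Finite (X ⟶ Y)) {Y X : C}
    (hExt : Finite (Ext.{max u v} X Y 1)) (p : Ext.{max u v} X Y 1 → Prop) :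
    IsFinsum (fun l : IsoCls C =>
      (Nat.card {s : SES Y l.out X // p s.2.cls} : ℚ) / (aut l.out : ℚ))
      ((Nat.card {ε // p ε} : ℚ) / (Nat.card (X ⟶ Y) : ℚ)) := by
  have := Fintype.ofFinite {ε // p ε}
  convert IsFinsum.sum (α := {ε // p ε}) fun ε => isFinsum_card_ses_cls hfin ε.1 using 1
  · ext l
    rw [← Finset.sum_div, ← Nat.cast_sum, ← Nat.card_sigma]
    congr 2
    exact Nat.card_congr
      { toFun := fun s => ⟨⟨s.1.2.cls, s.2⟩, s.1, rfl⟩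
        invFun := fun s => ⟨s.2.1, by simpa only [s.2.2] using s.1.2⟩
        left_inv := fun s => rfl
        right_inv := by rintro ⟨⟨ε, hε⟩, s, h⟩; obtain rfl : s.2.cls = ε := h; rfl }
  · simp [div_eq_mul_inv]

theorem IsSES.of_lift {N L M : C} {i : N ⟶ L} {p : L ⟶ M} (hi : Mono i) (hp : Epi p)
    (w : i ≫ p = 0) (h : ∀ {T : C} (t : T ⟶ L), t ≫ p = 0 → ∃ s, s ≫ i = t) : IsSES i p := by
  refine ⟨w, ⟨?_⟩⟩
  rw [ShortComplex.exact_iff_kernel_ι_comp_cokernel_π_zero]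
  obtain ⟨s, hs⟩ := h (kernel.ι p) (kernel.condition p)
  simp [← hs]

theorem IsSES.of_desc {N L M : C} {i : N ⟶ L} {p : L ⟶ M} (hi : Mono i) (hp : Epi p)
    (w : i ≫ p = 0) (h : ∀ {T : C} (t : L ⟶ T), i ≫ t = 0 → ∃ s, p ≫ s = t) : IsSES i p := by
  refine ⟨w, ⟨?_⟩⟩
  rw [ShortComplex.exact_iff_kernel_ι_comp_cokernel_π_zero]
  obtain ⟨s, hs⟩ := h (cokernel.π i) (cokernel.condition i)
  simp [← hs]

theorem IsSES.of_extMap {N₁ P M N₂ L N : C} {r : N₁ ⟶ P} {k : P ⟶ M} (hK : IsSES r k)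
    {n : N₂ ⟶ L} {π : L ⟶ P} (hS : IsSES n π) {c : N₂ ⟶ N} {d : N ⟶ N₁} (hT : IsSES c d)
    {i : N ⟶ L} (h₁ : c ≫ i = n) (h₂ : i ≫ π = d ≫ r) : IsSES i (π ≫ k) := by
  have := hK.mono
  have := hK.epi
  have := hS.mono
  have := hS.epi
  have := hT.epi
  refine .of_desc (Preadditive.mono_of_cancel_zero _ fun t ht => ?_) inferInstance ?_ fun t ht => ?_
  · obtain ⟨s, rfl⟩ := hT.exists_lift t (by
      rw [← cancel_mono r, Category.assoc, ← h₂, reassoc_of% ht, zero_comp, zero_comp])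
    have hs : s = 0 := by rw [← cancel_mono n, ← h₁, ← Category.assoc, ht, zero_comp]
    rw [hs, zero_comp]
  · rw [reassoc_of% h₂, hK.zero, comp_zero]
  · obtain ⟨y, rfl⟩ := hS.exists_desc t (by rw [← h₁, Category.assoc, ht, comp_zero])
    obtain ⟨z, rfl⟩ := hK.exists_desc y (by
      rw [← cancel_epi d, ← reassoc_of% h₂, ht, comp_zero])
    exact ⟨z, by simp⟩

section Frames

variable {M N M' N' M₁ M₂ N₁ N₂ P : C}
  {a : M₂ ⟶ M} {b : M ⟶ M₁} (hS : IsSES a b) {c : N₂ ⟶ N} {d : N ⟶ N₁} (hT : IsSES c d)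
  {e : N₁ ⟶ M'} {f : M' ⟶ M₁} (hs : IsSES e f) {g : N₂ ⟶ N'} {h : N' ⟶ M₂} (ht : IsSES g h)
  {k : P ⟶ M} {k' : P ⟶ M'} (hP : IsPullback k k' b f)

include hs hP in
theorem isSES_pullback {r : N₁ ⟶ P} (hr : r ≫ k = 0) (hr' : r ≫ k' = e) : IsSES r k := by
  have := hs.mono
  have := hs.epi
  have : Epi k := epi_fst_of_isLimit _ _ hP.isLimit
  refine .of_lift ?_ this hr fun t ht => ?_
  · have := hs.mono
    rw [← hr'] at this
    exact mono_of_mono r k'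
  · obtain ⟨s, hs⟩ := hs.exists_lift (t ≫ k') (by
      rw [Category.assoc, ← hP.w, reassoc_of% ht, zero_comp])
    exact ⟨s, hP.hom_ext (by simp [hr, ht]) (by simp [hr', hs])⟩

include hS hs hP in
theorem isSES_biprod {l : M₂ ⟶ P} (hl : l ≫ k = a) (hl' : l ≫ k' = 0) {r : N₁ ⟶ P}
    (hr : r ≫ k = 0) (hr' : r ≫ k' = e) : IsSES (biprod.desc l r) (k ≫ b) := by
  have hK := isSES_pullback hs hP hr hr'
  have := hS.mono
  have := hS.epi
  have := hK.mono
  have := hK.epi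
  have := hs.mono
  refine .of_lift (Preadditive.mono_of_cancel_zero _ fun t ht => ?_) inferInstance ?_ fun t ht => ?_
  · have h₁ : t ≫ biprod.fst = 0 := by
      rw [← cancel_mono a]
      simpa [biprod.desc_eq, hl, hr] using congrArg (· ≫ k) ht
    have h₂ : t ≫ biprod.snd = 0 := by
      rw [← cancel_mono e]
      simpa [biprod.desc_eq, hl', hr'] using congrArg (· ≫ k') ht
    exact biprod.hom_ext _ _ (by simpa using h₁) (by simpa using h₂)
  · ext
    · simp [reassoc_of% hl, hS.zero]
    · simp [reassoc_of% hr]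
  · obtain ⟨s, hs⟩ := hS.exists_lift (t ≫ k) (by simpa using ht)
    obtain ⟨s', hs'⟩ := hK.exists_lift (t - s ≫ l) (by simp [hl, hs])
    exact ⟨biprod.lift s s', by simp [hs']⟩

/-- The pairs of crossing extensions filling in a given frame of short exact sequences. -/
def Fill (a : M₂ ⟶ M) (b : M ⟶ M₁) (c : N₂ ⟶ N) (d : N ⟶ N₁) (e : N₁ ⟶ M') (f : M' ⟶ M₁)
    (g : N₂ ⟶ N') (h : N' ⟶ M₂) (L : C) : Type v :=
  {x : SES N L M × SES N' L M' // c ≫ x.1.1.1 = g ≫ x.2.1.1 ∧ x.1.1.1 ≫ x.2.1.2 = d ≫ e ∧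
    x.2.1.1 ≫ x.1.1.2 = h ≫ a ∧ x.1.1.2 ≫ b = x.2.1.2 ≫ f}

include hS hT hs ht hP in
theorem isSES_of_fill {l : M₂ ⟶ P} (hl : l ≫ k = a) (hl' : l ≫ k' = 0) {r : N₁ ⟶ P}
    (hr : r ≫ k = 0) (hr' : r ≫ k' = e) {L : C} {i : N ⟶ L} {p : L ⟶ M} (hL : IsSES i p)
    {i' : N' ⟶ L} {p' : L ⟶ M'} (hL' : IsSES i' p')
    (h₂ : i ≫ p' = d ≫ e) (h₃ : i' ≫ p = h ≫ a) (h₄ : p ≫ b = p' ≫ f) :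
    IsSES (c ≫ i) (hP.lift p p' h₄) := by
  have hB := isSES_biprod hS hs hP hl hl' hr hr'
  have := hT.mono
  have := hT.epi
  have := hs.mono
  have := ht.epi
  have := hL.mono
  have := hL.epi
  have := hS.epi
  have hd : i ≫ hP.lift p p' h₄ = d ≫ r :=
    hP.hom_ext (by simp [hL.zero, hr]) (by simp [h₂, hr'])
  have hh : i' ≫ hP.lift p p' h₄ = h ≫ l :=
    hP.hom_ext (by simp [h₃, hl]) (by simp [hL'.zero, hl'])
  refine .of_lift inferInstance (Preadditive.epi_of_cancel_zero _ fun z hz => ?_) ?_ fun t hz => ?_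
  · have hrz : r ≫ z = 0 := by
      rw [← cancel_epi d, ← reassoc_of% hd, hz]
      simp
    have hlz : l ≫ z = 0 := by
      rw [← cancel_epi h, ← reassoc_of% hh, hz]
      simp
    obtain ⟨y, rfl⟩ := hB.exists_desc z (by
      ext <;> simp [hrz, hlz])
    have hy : y = 0 := by
      rw [← cancel_epi b, ← cancel_epi p]
      simpa using hz
    rw [hy, comp_zero]
  · rw [Category.assoc, hd, reassoc_of% hT.zero, zero_comp]
  · have hz₁ : t ≫ p = 0 := by simpa using congrArg (· ≫ k) hz
    have hz₂ : t ≫ p' = 0 := by simpa using congrArg (· ≫ k') hz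
    obtain ⟨s, rfl⟩ := hL.exists_lift t hz₁
    obtain ⟨s', rfl⟩ := hT.exists_lift s (by
      rw [← cancel_mono e, Category.assoc, ← h₂, ← Category.assoc, hz₂, zero_comp])
    exact ⟨s', by simp⟩

/-- Fillings of a frame are extensions of the pullback together with two morphisms of extensions. -/
noncomputable def fillEquiv {l : M₂ ⟶ P} (hl : l ≫ k = a) (hl' : l ≫ k' = 0) {r : N₁ ⟶ P}
    (hr : r ≫ k = 0) (hr' : r ≫ k' = e) (L : C) :
    Fill a b c d e f g h L ≃
      Σ s : SES N₂ L P, ExtMap s.1.1 s.1.2 c d r × ExtMap s.1.1 s.1.2 g h l where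
  toFun x := ⟨⟨(c ≫ x.1.1.1.1, hP.lift x.1.1.1.2 x.1.2.1.2 x.2.2.2.2),
      isSES_of_fill hS hT hs ht hP hl hl' hr hr' x.1.1.2 x.1.2.2 x.2.2.1 x.2.2.2.1 _⟩,
    ⟨x.1.1.1.1, rfl, hP.hom_ext (by simp [x.1.1.2.zero, hr]) (by simp [x.2.2.1, hr'])⟩,
    ⟨x.1.2.1.1, x.2.1.symm, hP.hom_ext (by simp [x.2.2.2.1, hl]) (by simp [x.1.2.2.zero, hl'])⟩⟩
  invFun x := ⟨⟨⟨(x.2.1.1, x.1.1.2 ≫ k),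
      (isSES_pullback hs hP hr hr').of_extMap x.1.2 hT x.2.1.2.1 x.2.1.2.2⟩,
    ⟨(x.2.2.1, x.1.1.2 ≫ k'),
      (isSES_pullback hS hP.flip hl' hl).of_extMap x.1.2 ht x.2.2.2.1 x.2.2.2.2⟩⟩,
    x.2.1.2.1.trans x.2.2.2.1.symm, by
      dsimp only
      rw [reassoc_of% x.2.1.2.2, hr'], by
      dsimp only
      rw [reassoc_of% x.2.2.2.2, hl], by
      dsimp only
      rw [Category.assoc, Category.assoc, hP.w]⟩
  left_inv x := by
    refine Subtype.ext (Prod.ext (Subtype.ext (Prod.ext rfl ?_)) (Subtype.ext (Prod.ext rfl ?_)))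
    · exact hP.lift_fst _ _ _
    · exact hP.lift_snd _ _ _
  right_inv := by
    rintro ⟨⟨⟨n, π⟩, hn⟩, ⟨i, hi, hi'⟩, ⟨j, hj, hj'⟩⟩
    dsimp only at hi hi' hj hj' hn
    subst hi
    have : hP.lift (π ≫ k) (π ≫ k') (by simp [hP.w]) = π := hP.hom_ext (by simp) (by simp)
    have key : ∀ (π' : L ⟶ P) (_ : π' = π) (h₁ : IsSES (c ≫ i) π')
        (h₂ : c ≫ i = c ≫ i ∧ i ≫ π' = d ≫ r) (h₃ : g ≫ j = c ≫ i ∧ j ≫ π' = h ≫ l),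
        (⟨⟨(c ≫ i, π'), h₁⟩, ⟨i, h₂⟩, ⟨j, h₃⟩⟩ :
          Σ s : SES N₂ L P, ExtMap s.1.1 s.1.2 c d r × ExtMap s.1.1 s.1.2 g h l) =
        ⟨⟨(c ≫ i, π), hn⟩, ⟨i, rfl, hi'⟩, ⟨j, hj, hj'⟩⟩ := by
      rintro _ rfl _ _ _
      rfl
    exact key _ this _ _ _

end Frames

theorem card_sigma_prod_of_iff {α : Type*} {β γ : α → Type*} [Finite α] [∀ a, Finite (β a)]
    [∀ a, Finite (γ a)] {p q : α → Prop} {m n : ℕ} (hp : ∀ a, Nonempty (β a) ↔ p a)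
    (hq : ∀ a, Nonempty (γ a) ↔ q a) (hm : ∀ a, p a → Nat.card (β a) = m)
    (hn : ∀ a, q a → Nat.card (γ a) = n) :
    Nat.card (Σ a, β a × γ a) = Nat.card {a // p a ∧ q a} * (m * n) := by
  have e : (Σ a, β a × γ a) ≃ Σ a : {a // p a ∧ q a}, β a × γ a :=
    { toFun := fun x => ⟨⟨x.1, (hp _).1 ⟨x.2.1⟩, (hq _).1 ⟨x.2.2⟩⟩, x.2⟩
      invFun := fun x => ⟨x.1.1, x.2⟩
      left_inv := fun _ => rfl
      right_inv := fun _ => rfl }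
  rw [Nat.card_congr e, card_sigma_const]
  intro a
  rw [Nat.card_prod, hm _ a.2.1, hn _ a.2.2]

theorem card_ext_biprod_fiber {X₁ X₂ P M Y : C} {l : X₁ ⟶ P} {r : X₂ ⟶ P} {g : P ⟶ M}
    (h : IsSES (biprod.desc l r) g) [Subsingleton (Ext.{max u v} M Y 2)]
    (η₁ : Ext.{max u v} X₁ Y 1) (η₂ : Ext.{max u v} X₂ Y 1) :
    Nat.card {ε : Ext.{max u v} P Y 1 // (Ext.mk₀ l).comp ε (zero_add 1) = η₁ ∧
        (Ext.mk₀ r).comp ε (zero_add 1) = η₂} *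
      (Nat.card (X₁ ⟶ Y) * Nat.card (X₂ ⟶ Y) * Nat.card (M ⟶ Y)) =
      Nat.card (Ext.{max u v} M Y 1) * Nat.card (P ⟶ Y) := by
  rw [← card_ext_fiber h (Ext.biprodAddEquiv.symm (η₁, η₂)), ← card_ext_zero (X₁ ⊞ X₂) Y,
    Nat.card_congr (Ext.biprodAddEquiv (X₁ := X₁) (X₂ := X₂) (Y := Y)).toEquiv, Nat.card_prod,
    card_ext_zero, card_ext_zero]
  congr 1
  refine Nat.card_congr (Equiv.subtypeEquivRight fun ε => ?_)
  rw [AddEquiv.eq_symm_apply, Prod.ext_iff]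
  simp [Ext.biprodAddEquiv, Ext.mk₀_comp_mk₀_assoc]

theorem isFinsum_card_fill (hfinHom : ∀ X Y : C, Finite (X ⟶ Y))
    (hfinExt : ∀ X Y : C, Finite (Ext.{max u v} X Y 1))
    (hhered : ∀ X Y : C, Subsingleton (Ext.{max u v} X Y 2))
    {M N M' N' M₁ M₂ N₁ N₂ : C}
    {a : M₂ ⟶ M} {b : M ⟶ M₁} (hS : IsSES a b) {c : N₂ ⟶ N} {d : N ⟶ N₁} (hT : IsSES c d)
    {e : N₁ ⟶ M'} {f : M' ⟶ M₁} (hs : IsSES e f) {g : N₂ ⟶ N'} {h : N' ⟶ M₂}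
    (ht : IsSES g h) :
    IsFinsum (fun L : IsoCls C => (Nat.card (Fill a b c d e f g h L.out) : ℚ) / (aut L.out : ℚ))
      ((Nat.card (Ext.{max u v} M₁ N₂ 1) : ℚ) / (Nat.card (M₁ ⟶ N₂) : ℚ)) := by
  have hP := IsPullback.of_hasPullback b f
  let l : M₂ ⟶ pullback b f := hP.lift a 0 (by simp [hS.zero])
  let r : N₁ ⟶ pullback b f := hP.lift 0 e (by simp [hs.zero])
  have hl : l ≫ pullback.fst b f = a := hP.lift_fst _ _ _
  have hl' : l ≫ pullback.snd b f = 0 := hP.lift_snd _ _ _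
  have hr : r ≫ pullback.fst b f = 0 := hP.lift_fst _ _ _
  have hr' : r ≫ pullback.snd b f = e := hP.lift_snd _ _ _
  let p (ε : Ext.{max u v} (pullback b f) N₂ 1) : Prop :=
    (Ext.mk₀ r).comp ε (zero_add 1) = hT.cls ∧ (Ext.mk₀ l).comp ε (zero_add 1) = ht.cls
  have hfin {Y L X N A : C} (n : Y ⟶ L) (π : L ⟶ X) (c : Y ⟶ N) (d : N ⟶ A) (u : A ⟶ X) :
    Finite (ExtMap n π c d u) := Subtype.finite
  have hcard (L : C) : Nat.card (Fill a b c d e f g h L) =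
      Nat.card {s : SES N₂ L (pullback b f) // p s.2.cls} *
        (Nat.card (N₁ ⟶ N₂) * Nat.card (M₂ ⟶ N₂)) := by
    rw [Nat.card_congr (fillEquiv hS hT hs ht hP hl hl' hr hr' L)]
    exact card_sigma_prod_of_iff (fun s => nonempty_extMap_iff s.2 hT r)
      (fun s => nonempty_extMap_iff s.2 ht l) (fun s => card_extMap s.2 hT r)
      (fun s => card_extMap s.2 ht l)
  have hfib := card_ext_biprod_fiber (isSES_biprod hS hs hP hl hl' hr hr') ht.cls hT.cls
  have key := (isFinsum_card_ses hfinHom (hfinExt _ _) p).const_mul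
    (Nat.card (N₁ ⟶ N₂) * Nat.card (M₂ ⟶ N₂))
  convert key using 1
  · ext L
    rw [hcard]
    push_cast
    ring
  · have h₁ : (Nat.card (M₁ ⟶ N₂) : ℚ) ≠ 0 := by exact_mod_cast Nat.card_pos.ne'
    have h₂ : (Nat.card (pullback b f ⟶ N₂) : ℚ) ≠ 0 := by exact_mod_cast Nat.card_pos.ne'
    rw [Nat.card_congr (Equiv.subtypeEquivRight fun _ => and_comm)] at hfib
    have hfib' := congrArg (Nat.cast : ℕ → ℚ) hfib
    push_cast at hfib'
    rw [mul_div_assoc', div_eq_div_iff h₁ h₂, ← hfib']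
    ring

namespace IsSES

variable {N L M : C} {i : N ⟶ L} {p : L ⟶ M}

/-- The subobject of the middle term given by a short exact sequence. -/
noncomputable def sub (h : IsSES i p) : Subobject L :=
  have := h.mono
  Subobject.mk i

theorem sub_eq_kernelSubobject (h : IsSES i p) {T : C} {φ : L ⟶ T} (m : M ⟶ T) [Mono m]
    (hφ : φ = p ≫ m) : h.sub = kernelSubobject φ := by
  subst hφ
  have := h.mono
  rw [kernelSubobject_comp_mono]
  obtain ⟨s, hs⟩ := h.exists_lift (kernelSubobject p).arrow (kernelSubobject_arrow_comp p)
  exact le_antisymm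
    (Subobject.mk_le_of_comm (factorThruKernelSubobject p i h.zero) (by simp))
    (Subobject.le_mk_of_comm s hs)

theorem sub_eq_imageSubobject (h : IsSES i p) {T : C} {φ : T ⟶ L} (r : T ⟶ N) [Epi r]
    (hφ : φ = r ≫ i) : h.sub = imageSubobject φ := by
  have := h.mono
  have hz : i ≫ cokernel.π (imageSubobject φ).arrow = 0 := by
    have := (imageSubobject_arrow_comp φ).trans hφ
    rw [← cancel_epi r, ← reassoc_of% this, cokernel.condition, comp_zero, comp_zero]
  obtain ⟨s, hs⟩ := h.exists_lift (imageSubobject φ).arrow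
    (imageSubobject_arrow_comp_eq_zero (by rw [hφ, Category.assoc, h.zero, comp_zero]))
  exact le_antisymm
    (Subobject.mk_le_of_comm (monoLift _ i hz) (monoLift_comp _ _ _))
    (Subobject.le_mk_of_comm s hs)

theorem of_sub_eq_kernelSubobject (h : IsSES i p) {T : C} {φ : L ⟶ T}
    (hφ : h.sub = kernelSubobject φ) :
    i ≫ φ = 0 ∧ ∀ {T' : C} (t : T' ⟶ L), t ≫ φ = 0 → ∃ s, s ≫ i = t := by
  have := h.mono
  change Subobject.mk i = _ at hφ
  constructor
  · rw [← Subobject.ofMkLE_arrow (le_of_eq hφ), Category.assoc, kernelSubobject_arrow_comp,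
      comp_zero]
  · intro T' t ht
    refine ⟨factorThruKernelSubobject φ t ht ≫ Subobject.ofLEMk _ i hφ.ge, ?_⟩
    rw [Category.assoc, Subobject.ofLEMk_comp, factorThruKernelSubobject_comp_arrow]

theorem of_sub_eq_imageSubobject (h : IsSES i p) {T : C} {φ : T ⟶ L}
    (hφ : h.sub = imageSubobject φ) : ∃ r : T ⟶ N, Epi r ∧ r ≫ i = φ := by
  have := h.mono
  change Subobject.mk i = _ at hφ
  refine ⟨factorThruImageSubobject φ ≫ (Subobject.isoOfEqMk _ i hφ.symm).hom,
    epi_comp _ _, ?_⟩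
  rw [Category.assoc, Subobject.isoOfEqMk_hom, Subobject.ofLEMk_comp, imageSubobject_arrow_comp]

end IsSES

/-- The isomorphism class of a subobject. -/
noncomputable def subCls {M : C} (A : Subobject M) : IsoCls C := .mk (A : C)

/-- The isomorphism class of the quotient by a subobject. -/
noncomputable def quotCls {M : C} (A : Subobject M) : IsoCls C := .mk (cokernel A.arrow)

theorem isSES_arrow {M : C} (A : Subobject M) : IsSES A.arrow (cokernel.π A.arrow) :=
  .of_lift inferInstance inferInstance (cokernel.condition _)
    fun t ht => ⟨monoLift _ t ht, monoLift_comp _ _ _⟩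

theorem IsSES.congr {N L M N' M' : C} {i : N ⟶ L} {p : L ⟶ M} (h : IsSES i p) (α : N' ≅ N)
    (β : M ≅ M') : IsSES (α.hom ≫ i) (p ≫ β.hom) :=
  ⟨by simp [reassoc_of% h.zero], ShortComplex.shortExact_of_iso
    (ShortComplex.isoMk (S₁ := ShortComplex.mk i p h.zero) α.symm (Iso.refl _) β
      (by simp) (by simp)) h.shortExact⟩

theorem exists_ses_sub_eq {M : C} (A : Subobject M) :
    ∃ s : SES (subCls A).out M (quotCls A).out, s.2.sub = A := by
  obtain ⟨α⟩ := nonempty_iso_out_iff.2 (Eq.refl (subCls A))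
  obtain ⟨β⟩ := nonempty_iso_out_iff.2 (Eq.refl (quotCls A))
  have h := (isSES_arrow A).congr α.symm β
  have := h.mono
  exact ⟨⟨(_, _), h⟩, Subobject.mk_eq_of_comm _ α.symm rfl⟩

/-- A chosen short exact sequence with given subobject. -/
noncomputable def subSES {M : C} (A : Subobject M) : SES (subCls A).out M (quotCls A).out :=
  (exists_ses_sub_eq A).choose

theorem subSES_sub {M : C} (A : Subobject M) : (subSES A).2.sub = A :=
  (exists_ses_sub_eq A).choose_spec

section Crosses

variable {M N M' N' L : C}

theorem exists_frame {M₁ M₂ N₁ N₂ : C} {i : N ⟶ L} {p : L ⟶ M} (hL : IsSES i p) {i' : N' ⟶ L}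
    {p' : L ⟶ M'} (hL' : IsSES i' p') {a : M₂ ⟶ M} {b : M ⟶ M₁} (hS : IsSES a b)
    {c : N₂ ⟶ N} {d : N ⟶ N₁} (hT : IsSES c d) (ha : hS.sub = imageSubobject (i' ≫ p))
    (hc : hT.sub = kernelSubobject (i ≫ p')) :
    ∃ (s : SES N₁ M' M₁) (t : SES N₂ N' M₂), c ≫ i = t.1.1 ≫ i' ∧ i ≫ p' = d ≫ s.1.1 ∧
      i' ≫ p = t.1.2 ≫ a ∧ p ≫ b = p' ≫ s.1.2 := by
  have := hS.mono
  have := hS.epi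
  have := hT.mono
  have := hT.epi
  have := hL.mono
  have := hL.epi
  have := hL'.mono
  have := hL'.epi
  obtain ⟨h, hh, hha⟩ := hS.of_sub_eq_imageSubobject ha
  obtain ⟨hz, hlift⟩ := hT.of_sub_eq_kernelSubobject hc
  obtain ⟨e, he⟩ := hT.exists_desc (i ≫ p') hz
  obtain ⟨f, hf⟩ := hL'.exists_desc (p ≫ b) (by rw [← reassoc_of% hha, hS.zero, comp_zero])
  obtain ⟨g, hg⟩ := hL'.exists_lift (c ≫ i) (by rw [Category.assoc, hz])
  have hef : IsSES e f := by
    have hepi : Epi (p' ≫ f) := by rw [hf]; infer_instance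
    refine .of_desc (Preadditive.mono_of_cancel_zero _ fun t ht => ?_) (epi_of_epi p' f) ?_
      fun z hz => ?_
    · obtain ⟨T', π, hπ, s, hs⟩ := surjective_up_to_refinements_of_epi d t
      obtain ⟨s', rfl⟩ := hlift s (by rw [← he, ← reassoc_of% hs, ht, comp_zero])
      rw [← cancel_epi π, hs, Category.assoc, hT.zero, comp_zero, comp_zero]
    · rw [← cancel_epi d, reassoc_of% he, hf, reassoc_of% hL.zero]
      simp
    · obtain ⟨y, hy⟩ := hL.exists_desc (p' ≫ z) (by rw [← reassoc_of% he, hz, comp_zero])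
      obtain ⟨w, rfl⟩ := hS.exists_desc y (by
        rw [← cancel_epi h, reassoc_of% hha, hy, reassoc_of% hL'.zero]
        simp)
      exact ⟨w, by rw [← cancel_epi p', reassoc_of% hf, hy]⟩
  have hgh : IsSES g h := by
    have hmono : Mono (g ≫ i') := by rw [hg]; infer_instance
    refine .of_lift (mono_of_mono g i') hh ?_ fun t ht => ?_
    · rw [← cancel_mono a, Category.assoc, hha, reassoc_of% hg, hL.zero]
      simp
    · obtain ⟨s, hs⟩ := hL.exists_lift (t ≫ i') (by
        rw [Category.assoc, ← hha, reassoc_of% ht, zero_comp])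
      obtain ⟨s', rfl⟩ := hlift s (by rw [reassoc_of% hs, hL'.zero, comp_zero])
      exact ⟨s', by rw [← cancel_mono i', Category.assoc, hg, ← hs, Category.assoc]⟩
  exact ⟨⟨(e, f), hef⟩, ⟨(g, h), hgh⟩, hg.symm, he.symm, hha.symm, hf.symm⟩

variable (M N M' N') in
/-- The data of all four sides of the frame of a cross, up to isomorphism of the corners. -/
def Frame : Type (max u v) :=
  Σ x : Subobject M × Subobject N, SES (quotCls x.2).out M' (quotCls x.1).out ×
    SES (subCls x.2).out N' (subCls x.1).out

/-- The fillings of a frame. -/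
abbrev Frame.Filling (y : Frame M N M' N') (L : C) : Type v :=
  Fill (subSES y.1.1).1.1 (subSES y.1.1).1.2 (subSES y.1.2).1.1 (subSES y.1.2).1.2
    y.2.1.1.1 y.2.1.1.2 y.2.2.1.1 y.2.2.1.2 L

theorem bijective_filling :
    Function.Bijective
      (fun x : Σ y : Frame M N M' N', y.Filling L => (x.2.1 : SES N L M × SES N' L M')) := by
  constructor
  · rintro ⟨⟨⟨A, B⟩, s, t⟩, ⟨x, hx⟩⟩ ⟨⟨⟨A', B'⟩, s', t'⟩, ⟨x', hx'⟩⟩ hxx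
    obtain rfl : x = x' := hxx
    dsimp only at hx hx'
    obtain ⟨h₁, h₂, h₃, h₄⟩ := hx
    obtain ⟨h₁', h₂', h₃', h₄'⟩ := hx'
    have := x.1.2.mono
    have := x.1.2.epi
    have := x.2.2.mono
    have := x.2.2.epi
    obtain rfl : A = A' := by
      have := t.2.epi
      have := t'.2.epi
      rw [← subSES_sub A, ← subSES_sub A', (subSES A).2.sub_eq_imageSubobject t.1.2 h₃,
        (subSES A').2.sub_eq_imageSubobject t'.1.2 h₃']
    obtain rfl : B = B' := by
      have := s.2.mono
      have := s'.2.mono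
      rw [← subSES_sub B, ← subSES_sub B', (subSES B).2.sub_eq_kernelSubobject s.1.1 h₂,
        (subSES B').2.sub_eq_kernelSubobject s'.1.1 h₂']
    have := (subSES A).2.mono
    have := (subSES B).2.epi
    obtain rfl : s = s' := by
      refine Subtype.ext (Prod.ext ?_ ?_)
      · rw [← cancel_epi (subSES B).1.2, ← h₂, ← h₂']
      · rw [← cancel_epi x.2.1.2, ← h₄, ← h₄']
    obtain rfl : t = t' := by
      refine Subtype.ext (Prod.ext ?_ ?_)
      · rw [← cancel_mono x.2.1.1, ← h₁, ← h₁']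
      · rw [← cancel_mono (subSES A).1.1, ← h₃, ← h₃']
    rfl
  · intro x
    obtain ⟨s, t, h⟩ := exists_frame x.1.2 x.2.2 (subSES _).2 (subSES _).2 (subSES_sub _)
      (subSES_sub _)
    exact ⟨⟨⟨(_, _), s, t⟩, ⟨x, h⟩⟩, rfl⟩

end Crosses

theorem isSES_arrow_sub {M : C} (A : Subobject M) : (isSES_arrow A).sub = A :=
  Subobject.mk_arrow A

theorem IsSES.congr_sub {N L M N' M' : C} {i : N ⟶ L} {p : L ⟶ M} (h : IsSES i p) (α : N' ≅ N)
    (β : M ≅ M') : (h.congr α β).sub = h.sub := by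
  have := h.mono
  have := (h.congr α β).mono
  exact Subobject.mk_eq_mk_of_comm _ _ α rfl

theorem IsSES.exists_iso_of_sub_eq {N₀ N L M₀ M : C} {i₀ : N₀ ⟶ L} {p₀ : L ⟶ M₀}
    (h₀ : IsSES i₀ p₀) {i : N ⟶ L} {p : L ⟶ M} (h : IsSES i p) (hsub : h.sub = h₀.sub) :
    ∃ (α : N ≅ N₀) (β : M₀ ≅ M), α.hom ≫ i₀ = i ∧ p₀ ≫ β.hom = p := by
  have := h₀.mono
  have := h₀.epi
  have := h.mono
  have := h.epi
  change Subobject.mk i = Subobject.mk i₀ at hsub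
  let α : N ≅ N₀ := Subobject.isoOfMkEqMk i i₀ hsub
  have hα : α.hom ≫ i₀ = i := Subobject.ofMkLEMk_comp _
  have hα' : α.inv ≫ i = i₀ := Subobject.ofMkLEMk_comp _
  obtain ⟨β, hβ⟩ := h₀.exists_desc p (by rw [← hα', Category.assoc, h.zero, comp_zero])
  obtain ⟨β', hβ'⟩ := h.exists_desc p₀ (by rw [← hα, Category.assoc, h₀.zero, comp_zero])
  exact ⟨α, ⟨β, β', by rw [← cancel_epi p₀, reassoc_of% hβ, hβ', Category.comp_id],
    by rw [← cancel_epi p, reassoc_of% hβ', hβ, Category.comp_id]⟩, hα, hβ⟩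

section HallNumbers

variable {N L M : C}

/-- The subobjects counted by a Hall number. -/
abbrev HallSet (L M N : C) : Type _ :=
  {L' : Subobject L // Nonempty ((L' : C) ≅ N) ∧ Nonempty (cokernel L'.arrow ≅ M)}

/-- The subobject in the middle term of a short exact sequence, as a member of the Hall set. -/
noncomputable def SES.toHallSet (s : SES N L M) : HallSet L M N :=
  ⟨s.2.sub, by
    obtain ⟨α, β, -, -⟩ := (isSES_arrow s.2.sub).exists_iso_of_sub_eq s.2
      (isSES_arrow_sub _).symm
    exact ⟨⟨α.symm⟩, ⟨β⟩⟩⟩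

theorem card_ses_fiber (x : HallSet L M N) :
    Nat.card {s : SES N L M // s.toHallSet = x} = aut N * aut M := by
  obtain ⟨A, ⟨α₀⟩, ⟨β₀⟩⟩ := x
  have h₀ := (isSES_arrow A).congr α₀.symm β₀
  have hA : h₀.sub = A := ((isSES_arrow A).congr_sub α₀.symm β₀).trans (isSES_arrow_sub A)
  have := h₀.mono
  have := h₀.epi
  rw [← card_iso_eq_aut (Iso.refl N), ← card_iso_eq_aut (Iso.refl M), ← Nat.card_prod]
  symm
  refine Nat.card_congr (Equiv.ofBijective
    (fun x => ⟨⟨(_, _), h₀.congr x.1 x.2⟩, Subtype.ext ((h₀.congr_sub x.1 x.2).trans hA)⟩) ⟨?_, ?_⟩)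
  · rintro ⟨α, β⟩ ⟨α', β'⟩ h
    have h' := congrArg (fun s => s.1.1) h
    obtain ⟨h₁, h₂⟩ := Prod.ext_iff.1 h'
    exact Prod.ext (Iso.ext ((cancel_mono _).1 h₁)) (Iso.ext ((cancel_epi _).1 h₂))
  · rintro ⟨s, hs⟩
    obtain ⟨α, β, h₁, h₂⟩ := h₀.exists_iso_of_sub_eq s.2 ((congrArg Subtype.val hs).trans hA.symm)
    exact ⟨(α, β), Subtype.ext (Subtype.ext (Prod.ext h₁ h₂))⟩

theorem card_ses [Finite (Subobject L)] [Finite (SES N L M)] :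
    Nat.card (SES N L M) = hallNum L M N * (aut N * aut M) := by
  rw [← Nat.card_congr (Equiv.sigmaFiberEquiv SES.toHallSet), card_sigma_const _ card_ses_fiber]
  rfl

theorem hallNum_out (L : C) (x y : IsoCls C) :
    hallNum L x.out y.out = Nat.card {A : Subobject L // quotCls A = x ∧ subCls A = y} := by
  refine Nat.card_congr (Equiv.subtypeEquivRight fun A => ?_)
  rw [nonempty_iso_out_iff, nonempty_iso_out_iff, and_comm, eq_comm, eq_comm (a := y)]
  rfl

end HallNumbers

theorem finsum_card_fiber_mul {α ι : Type*} [Fintype α] (κ : α → ι) (G : ι → ℚ) :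
    ∑ᶠ x, (Nat.card {a // κ a = x} : ℚ) * G x = ∑ a, G (κ a) := by
  classical
  have key : IsFinsum (fun x => ∑ a, if κ a = x then G x else 0) (∑ a, G (κ a)) :=
    IsFinsum.sum fun a => by
      simpa using isFinsum_single (f := fun x => if κ a = x then G x else 0) (κ a)
        fun x hx => if_neg hx.symm
  rw [← key.2]
  refine finsum_congr fun x => ?_
  dsimp only
  rw [← Finset.sum_filter, Finset.sum_const, Nat.card_eq_fintype_card, Fintype.card_subtype,
    nsmul_eq_mul]

theorem pow_log_card_module {F : Type} [Field F] [Fintype F] (V : Type*) [AddCommGroup V]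
    [Module F V] [Finite V] :
    Fintype.card F ^ Nat.log (Fintype.card F) (Nat.card V) = Nat.card V := by
  have : Module.Finite F V := Module.Finite.of_finite
  rw [Module.natCard_eq_pow_finrank (K := F), Nat.card_eq_fintype_card,
    Nat.log_pow Fintype.one_lt_card]

theorem zpow_neg_euler {F : Type} [Field F] [Fintype F] [CategoryTheory.Linear F C] (M N : C)
    [Finite (M ⟶ N)] [Finite (Ext.{max u v} M N 1)] :
    (Fintype.card F : ℚ) ^ (-euler (Fintype.card F) M N) =
      (Nat.card (Ext.{max u v} M N 1) : ℚ) / (Nat.card (M ⟶ N) : ℚ) := by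
  have hF : (Fintype.card F : ℚ) ≠ 0 := by exact_mod_cast Fintype.card_ne_zero
  rw [euler, neg_sub, zpow_sub₀ hF, zpow_natCast, zpow_natCast]
  norm_cast
  rw [pow_log_card_module (F := F), pow_log_card_module (F := F)]

theorem finite_frame (hfinHom : ∀ X Y : C, Finite (X ⟶ Y)) (hfinSub : ∀ X : C, Finite (Subobject X))
    (M N M' N' : C) : Finite (Frame M N M' N') := by
  unfold Frame
  infer_instance

theorem card_ses_prod_eq_sum (hfinHom : ∀ X Y : C, Finite (X ⟶ Y)) (M N M' N' L : C)
    [Fintype (Frame M N M' N')] :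
    Nat.card (SES N L M) * Nat.card (SES N' L M') =
      ∑ y : Frame M N M' N', Nat.card (y.Filling L) := by
  have (y : Frame M N M' N') : Finite (y.Filling L) := by
    unfold Frame.Filling Fill
    infer_instance
  rw [← Nat.card_prod, ← Nat.card_eq_of_bijective _ bijective_filling, Nat.card_sigma]

theorem aut_mul_finsum_hallNum (hfinHom : ∀ X Y : C, Finite (X ⟶ Y))
    (hfinExt : ∀ X Y : C, Finite (Abelian.Ext.{max u v} X Y 1))
    (hfinSub : ∀ X : C, Finite (Subobject X))
    (hhered : ∀ X Y : C, Subsingleton (Abelian.Ext.{max u v} X Y 2))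
    (M N M' N' : C) [Fintype (Frame M N M' N')] :
    (aut M * aut N * aut M' * aut N' : ℚ) *
        ∑ᶠ l : IsoCls C, (hallNum l.out M N * hallNum l.out M' N' : ℚ) / (aut l.out : ℚ) =
      ∑ y : Frame M N M' N',
        (Nat.card (Ext.{max u v} (quotCls y.1.1).out (subCls y.1.2).out 1) : ℚ) /
          Nat.card ((quotCls y.1.1).out ⟶ (subCls y.1.2).out) := by
  have key := IsFinsum.sum fun y : Frame M N M' N' => isFinsum_card_fill hfinHom hfinExt hhered
    (subSES y.1.1).2 (subSES y.1.2).2 y.2.1.2 y.2.2.2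
  rw [← key.2, mul_finsum]
  · refine finsum_congr fun l => ?_
    have h := card_ses_prod_eq_sum hfinHom M N M' N' l.out
    rw [card_ses, card_ses] at h
    dsimp only
    rw [← Finset.sum_div, ← Nat.cast_sum, ← h]
    push_cast
    ring

/-- A product of two Hall numbers counts the pairs of subobjects of `M` and `N` which, together with
their quotients, lie in the given classes. -/
theorem hallNum_mul_hallNum (M N : C) (x : IsoCls C × IsoCls C × IsoCls C × IsoCls C) :
    hallNum M x.1.out x.2.1.out * hallNum N x.2.2.1.out x.2.2.2.out =
      Nat.card {y : Subobject M × Subobject N //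
        (quotCls y.1, subCls y.1, quotCls y.2, subCls y.2) = x} := by
  rw [hallNum_out, hallNum_out, ← Nat.card_prod]
  refine Nat.card_congr (Equiv.subtypeProdEquivProd.symm.trans
    (Equiv.subtypeEquivRight fun y => ?_))
  simp only [Prod.ext_iff, and_assoc]

theorem sum_frame_eq_sum_subobject (hfinHom : ∀ X Y : C, Finite (X ⟶ Y))
    (hfinSub : ∀ X : C, Finite (Subobject X)) (M N M' N' : C) [Fintype (Frame M N M' N')]
    [Fintype (Subobject M × Subobject N)] (w : Subobject M × Subobject N → ℚ) :
    ∑ y : Frame M N M' N', w y.1 =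
      ∑ x : Subobject M × Subobject N,
        ((hallNum M' (quotCls x.1).out (quotCls x.2).out *
            (aut (quotCls x.2).out * aut (quotCls x.1).out)) *
          (hallNum N' (subCls x.1).out (subCls x.2).out *
            (aut (subCls x.2).out * aut (subCls x.1).out)) : ℕ) * w x := by
  have (x : Subobject M × Subobject N) :
      Fintype (SES (quotCls x.2).out M' (quotCls x.1).out ×
        SES (subCls x.2).out N' (subCls x.1).out) := .ofFinite _
  let e : Frame M N M' N' ≃ Σ x : Subobject M × Subobject N,
      SES (quotCls x.2).out M' (quotCls x.1).out × SES (subCls x.2).out N' (subCls x.1).out :=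
    Equiv.refl _
  rw [Fintype.sum_equiv e (fun y => w y.1) (fun y => w y.1) fun _ => rfl, Fintype.sum_sigma]
  simp only [← card_ses, ← Nat.card_prod]
  simp [Nat.card_eq_fintype_card]

/-- Green's formula. -/
theorem green_formula (q : ℕ) (hq : IsPrimePow q)
    (F : Type) [Field F] [Fintype F] (hF : Fintype.card F = q)
    [CategoryTheory.Linear F C] [EssentiallySmall.{v} C]
    -- finitary: all Hom-spaces and Ext¹-groups are finite
    (hfinHom : ∀ X Y : C, Finite (X ⟶ Y))
    (hfinExt : ∀ X Y : C, Finite (Abelian.Ext.{max u v} X Y 1))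
    -- every object has finitely many subobjects
    (hfinSub : ∀ X : C, Finite (Subobject X))
    -- hereditary: Ext² vanishes
    (hhered : ∀ X Y : C, Subsingleton (Abelian.Ext.{max u v} X Y 2))
    (M N M' N' : C) :
    (aut M * aut N * aut M' * aut N' : ℚ) *
        ∑ᶠ l : IsoCls C,
          (hallNum l.out M N * hallNum l.out M' N' : ℚ) / (aut l.out : ℚ)
      = ∑ᶠ x : IsoCls C × IsoCls C × IsoCls C × IsoCls C,
          (q : ℚ) ^ (-(euler q x.1.out x.2.2.2.out)) *
            (hallNum M x.1.out x.2.1.out : ℚ) *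
            (hallNum N x.2.2.1.out x.2.2.2.out : ℚ) *
            (hallNum M' x.1.out x.2.2.1.out : ℚ) *
            (hallNum N' x.2.1.out x.2.2.2.out : ℚ) *
            (aut x.1.out : ℚ) * (aut x.2.1.out : ℚ) *
            (aut x.2.2.1.out : ℚ) * (aut x.2.2.2.out : ℚ) := by
  subst hF
  have := finite_frame hfinHom hfinSub M N M' N'
  have : Fintype (Frame M N M' N') := .ofFinite _
  have : Fintype (Subobject M × Subobject N) := .ofFinite _
  rw [aut_mul_finsum_hallNum hfinHom hfinExt hfinSub hhered]
  rw [sum_frame_eq_sum_subobject hfinHom hfinSub M N M' N' fun x =>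
    (Nat.card (Ext.{max u v} (quotCls x.1).out (subCls x.2).out 1) : ℚ) /
      Nat.card ((quotCls x.1).out ⟶ (subCls x.2).out)]
  have key := finsum_card_fiber_mul
    (fun y : Subobject M × Subobject N => (quotCls y.1, subCls y.1, quotCls y.2, subCls y.2))
    fun x : IsoCls C × IsoCls C × IsoCls C × IsoCls C =>
      (Fintype.card F : ℚ) ^ (-(euler (Fintype.card F) x.1.out x.2.2.2.out)) *
        (hallNum M' x.1.out x.2.2.1.out : ℚ) * (hallNum N' x.2.1.out x.2.2.2.out : ℚ) *
        (aut x.1.out : ℚ) * (aut x.2.1.out : ℚ) *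
        (aut x.2.2.1.out : ℚ) * (aut x.2.2.2.out : ℚ)
  simp only [← hallNum_mul_hallNum, zpow_neg_euler] at key
  simp only [zpow_neg_euler]
  convert key.symm using 1
  · refine Finset.sum_congr rfl fun x _ => ?_
    push_cast
    ring
  · refine finsum_congr fun x => ?_
    push_cast
    ring

end GreenFormulaCat
end
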